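/- arXiv:2305.18210 — 8 statements merged into one kernel-verified Lean document; each statement's English description precedes it below -/
import Mathlib

section
/- Let d ≥ 2 and let π : ℝ^d → ℝ be an everywhere strictly positive probability density with respect to Lebesgue measure whose second-order partial derivatives exist everywhere (e.g., π is C²). Let μ be the probability measure on ℝ^d with density π, and let X_i(x) = x_i denote the coordinate projections. Then for any two distinct indices k, ℓ ∈ {1,…,d}, the random variables X_k and X_ℓ are conditionally independent given the σ-algebra generated by the remaining coordinates (X_i)_{i ∉ {k,ℓ}} under μ if and only if the mixed partial derivative ∂²(log π)/∂x_k ∂x_ℓ (x) = 0 for all x ∈ ℝ^d. -/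
open MeasureTheory ProbabilityTheory
open scoped ENNReal

lemma cross_iff {V : Type*} [NormedAddCommGroup V] [NormedSpace ℝ V] (h : V → ℝ)
    (hh : ContDiff ℝ 2 h) (e f : V) :
    (∀ x, fderiv ℝ (fun y => fderiv ℝ h y e) x f = 0) ↔
      ∀ x (u v : ℝ), h (x + u • e + v • f) + h x = h (x + u • e) + h (x + v • f) := by
  have hd : Differentiable ℝ h := hh.differentiable (by norm_num)
  have hd2 : Differentiable ℝ (fun y => fderiv ℝ h y e) := by
    have : ContDiff ℝ 1 (fderiv ℝ h) := hh.fderiv_right (by norm_num)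
    exact (this.differentiable (by norm_num)).clm_apply (differentiable_const e)
  have line : ∀ (g : V → ℝ), Differentiable ℝ g → ∀ (x w : V) (t : ℝ),
      HasDerivAt (fun t : ℝ => g (x + t • w)) (fderiv ℝ g (x + t • w) w) t := by
    intro g hg x w t
    have h1 : HasDerivAt (fun t : ℝ => x + t • w) w t := by
      simpa using ((hasDerivAt_id t).smul_const w).const_add x
    exact (hg (x + t • w)).hasFDerivAt.comp_hasDerivAt t h1
  constructor
  · intro H x u v
    have c1 : ∀ (y : V) (v : ℝ), fderiv ℝ h (y + v • f) e = fderiv ℝ h y e := by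
      intro y v
      have := is_const_of_deriv_eq_zero (f := fun t : ℝ => fderiv ℝ h (y + t • f) e)
        (fun t => (line _ hd2 y f t).differentiableAt)
        (fun t => by rw [(line _ hd2 y f t).deriv]; exact H _) v 0
      simpa using this
    have key : ∀ t, HasDerivAt (fun t : ℝ => h ((x + v • f) + t • e) - h (x + t • e)) 0 t := by
      intro t
      have := (line h hd (x + v • f) e t).sub (line h hd x e t)
      have e1 : x + v • f + t • e = (x + t • e) + v • f := by abel
      rw [e1, c1, sub_self] at this
      exact this
    have := is_const_of_deriv_eq_zero (fun t => (key t).differentiableAt)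
      (fun t => (key t).deriv) u 0
    simp only [zero_smul, add_zero] at this
    have e1 : x + v • f + u • e = (x + u • e) + v • f := by abel
    rw [e1] at this
    linarith
  · intro H x
    have c1 : ∀ v : ℝ, fderiv ℝ h (x + v • f) e = fderiv ℝ h x e := by
      intro v
      have l1 := line h hd (x + v • f) e 0
      have l2 := (line h hd x e 0).add_const (h (x + v • f) - h x)
      have : (fun t : ℝ => h (x + v • f + t • e)) =
          fun t : ℝ => h (x + t • e) + (h (x + v • f) - h x) := by
        funext t
        have := H x t v
        have e1 : x + v • f + t • e = (x + t • e) + v • f := by abel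
        rw [e1]; linarith
      rw [this] at l1
      simpa using l1.unique l2
    have l := line _ hd2 x f 0
    simp only [c1] at l
    have := l.unique (hasDerivAt_const (0:ℝ) (fderiv ℝ h x e))
    simpa using this

/-- glue -/
def glue {d : ℕ} (k l : Fin d) (w : ({i : Fin d // i ≠ k ∧ i ≠ l} → ℝ) × ℝ × ℝ) : Fin d → ℝ :=
  fun i => if h : i ≠ k ∧ i ≠ l then w.1 ⟨i, h⟩ else if i = k then w.2.1 else w.2.2

lemma glue_k {d : ℕ} (k l : Fin d) (w) : glue k l w k = w.2.1 := by simp [glue]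
lemma glue_l {d : ℕ} (k l : Fin d) (hkl : k ≠ l) (w) : glue k l w l = w.2.2 := by
  simp [glue, hkl.symm]
lemma glue_r {d : ℕ} (k l : Fin d) (w) (i : {i : Fin d // i ≠ k ∧ i ≠ l}) :
    glue k l w i.1 = w.1 i := by
  simp [glue, i.2.1, i.2.2]

lemma glue_self {d : ℕ} (k l : Fin d) (x : Fin d → ℝ) :
    glue k l (fun i => x i.1, x k, x l) = x := by
  funext i
  unfold glue
  split_ifs with h1 h2
  · rfl
  · simp [h2]
  · have : i = l := by tauto
    simp [this]

lemma glue_cont {d : ℕ} (k l : Fin d) : Continuous (glue k l) := by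
  refine continuous_pi fun i => ?_
  unfold glue
  split_ifs <;> fun_prop

lemma glue_map {d : ℕ} (k l : Fin d) (hkl : k ≠ l) :
    Measure.map (glue k l) (volume.prod (volume.prod volume)) = volume := by
  symm
  rw [volume_pi]
  refine Measure.pi_eq fun s hs => ?_
  rw [Measure.map_apply (glue_cont k l).measurable (MeasurableSet.univ_pi hs)]
  have : glue k l ⁻¹' (Set.univ.pi s) =
      (Set.univ.pi fun i : {i : Fin d // i ≠ k ∧ i ≠ l} => s i.1) ×ˢ (s k ×ˢ s l) := by
    ext w
    simp only [Set.mem_preimage, Set.mem_pi, Set.mem_univ, true_imp_iff, Set.mem_prod]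
    constructor
    · intro H
      refine ⟨fun i => ?_, ?_, ?_⟩
      · rw [← glue_r k l w i]; exact H _
      · rw [← glue_k k l w]; exact H _
      · rw [← glue_l k l hkl w]; exact H _
    · rintro ⟨h1, h2, h3⟩ i
      by_cases h : i ≠ k ∧ i ≠ l
      · rw [glue_r k l w ⟨i, h⟩]; exact h1 ⟨i, h⟩
      · by_cases h' : i = k
        · subst h'; rw [glue_k]; exact h2
        · have : i = l := by tauto
          subst this; rw [glue_l _ _ hkl]; exact h3
  rw [this, Measure.prod_prod, Measure.prod_prod, volume_pi_pi]
  rw [← Fintype.prod_subtype_mul_prod_subtype (p := fun i => i ≠ k ∧ i ≠ l)]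
  congr 1
  have h2 : ∏ i : {i : Fin d // ¬ (i ≠ k ∧ i ≠ l)}, volume (s i.1) =
      ∏ i ∈ ({k, l} : Finset (Fin d)), volume (s i) := by
    symm
    refine Finset.prod_subtype _ (fun i => ?_) _
    simp; tauto
  rw [h2, Finset.prod_pair hkl]

lemma K_of_cross (q : ℝ → ℝ → ℝ≥0∞) (hq : Measurable (Function.uncurry q))
    (hc : ∀ a b a' b', q a b * q a' b' = q a b' * q a' b) (s t : Set ℝ) :
    (∫⁻ a in s, ∫⁻ b in t, q a b) * (∫⁻ a, ∫⁻ b, q a b) =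
      (∫⁻ a in s, ∫⁻ b, q a b) * (∫⁻ a, ∫⁻ b in t, q a b) := by
  have m1 : ∀ a, Measurable (q a) := fun a => hq.comp measurable_prodMk_left
  have m2 : ∀ b, Measurable (fun a => q a b) := fun b => hq.comp measurable_prodMk_right
  have mA : ∀ t : Set ℝ, Measurable (fun a => ∫⁻ b in t, q a b) := fun t =>
    hq.lintegral_prod_right
  have mA' : Measurable (fun a => ∫⁻ b, q a b) := hq.lintegral_prod_right
  have mB : Measurable (fun b => ∫⁻ a, q a b) := hq.lintegral_prod_left
  have key : ∀ a b, q a b * (∫⁻ a, ∫⁻ b, q a b) = (∫⁻ b, q a b) * (∫⁻ a, q a b) := by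
    intro a b
    rw [← lintegral_const_mul _ mA', ← lintegral_const_mul _ (m2 b)]
    refine lintegral_congr fun a' => ?_
    rw [← lintegral_const_mul _ (m1 a'), ← lintegral_mul_const _ (m1 a)]
    exact lintegral_congr fun b' => hc _ _ _ _
  have sw : (∫⁻ a, ∫⁻ b in t, q a b) = ∫⁻ b in t, ∫⁻ a, q a b :=
    lintegral_lintegral_swap hq.aemeasurable
  rw [sw, ← lintegral_mul_const _ (mA t), ← lintegral_mul_const _ mA']
  refine lintegral_congr fun a => ?_
  rw [← lintegral_mul_const _ (m1 a), ← lintegral_const_mul _ mB]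
  exact lintegral_congr fun b => key a b

lemma K_ge (q : ℝ → ℝ → ℝ≥0∞) (s t : Set ℝ) (hs : MeasurableSet s) (ht : MeasurableSet t)
    (c : ℝ≥0∞) (h : ∀ a ∈ s, ∀ b ∈ t, c ≤ q a b) :
    c * (volume t * volume s) ≤ ∫⁻ a in s, ∫⁻ b in t, q a b := by
  rw [← mul_assoc, ← setLIntegral_const]
  refine setLIntegral_mono' hs fun a ha => ?_
  rw [← setLIntegral_const]
  exact setLIntegral_mono' ht fun b hb => h a ha b hb

lemma K_le (q : ℝ → ℝ → ℝ≥0∞) (s t : Set ℝ) (hs : MeasurableSet s) (ht : MeasurableSet t)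
    (c : ℝ≥0∞) (h : ∀ a ∈ s, ∀ b ∈ t, q a b ≤ c) :
    (∫⁻ a in s, ∫⁻ b in t, q a b) ≤ c * (volume t * volume s) := by
  rw [← mul_assoc, ← setLIntegral_const]
  refine setLIntegral_mono' hs fun a ha => ?_
  rw [← setLIntegral_const]
  exact setLIntegral_mono' ht fun b hb => h a ha b hb

lemma cross_of_K {E : Type*} [PseudoMetricSpace E] [MeasureSpace E]
    [Measure.IsOpenPosMeasure (volume : Measure E)]
    (p : E × ℝ × ℝ → ℝ) (hp : Continuous p) (hpos : ∀ w, 0 < p w)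
    (P : E → ℝ≥0∞) (hP0 : ∀ z, P z ≠ 0) (hP : ∀ᵐ z, P z ≠ ∞)
    (H : ∀ s t : Set ℝ, MeasurableSet s → MeasurableSet t → ∀ᵐ z : E,
      (∫⁻ a in s, ∫⁻ b in t, ENNReal.ofReal (p (z, a, b))) * P z =
      (∫⁻ a in s, ∫⁻ b, ENNReal.ofReal (p (z, a, b))) *
        (∫⁻ a, ∫⁻ b in t, ENNReal.ofReal (p (z, a, b))))
    (z : E) (a b a' b' : ℝ) :
    p (z, a, b) * p (z, a', b') ≤ p (z, a, b') * p (z, a', b) := by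
  by_contra! hlt
  obtain ⟨r, hr, hr0⟩ : ∃ r : ℝ, (((p (z, a, b') + r) * (p (z, a', b) + r) <
      (p (z, a, b) - r) * (p (z, a', b') - r)) ∧ r < p (z, a, b) ∧ r < p (z, a', b')) ∧ 0 < r := by
    have e1 : ∀ᶠ r : ℝ in nhds 0, (p (z, a, b') + r) * (p (z, a', b) + r) <
      (p (z, a, b) - r) * (p (z, a', b') - r) := by
      refine (ContinuousAt.eventually_lt (by fun_prop) (by fun_prop) ?_)
      simpa using hlt
    have e2 : ∀ᶠ r : ℝ in nhds 0, r < p (z, a, b) := eventually_lt_nhds (hpos _)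
    have e3 : ∀ᶠ r : ℝ in nhds 0, r < p (z, a', b') := eventually_lt_nhds (hpos _)
    have e4 : ∀ᶠ r : ℝ in nhdsWithin 0 (Set.Ioi 0), 0 < r := self_mem_nhdsWithin
    exact (((e1.and (e2.and e3)).filter_mono nhdsWithin_le_nhds).and e4).exists
  obtain ⟨hr1, hr2, hr3⟩ := hr
  have loc : ∀ a b : ℝ, ∃ δ > 0, ∀ δ', δ' ≤ δ → ∀ z' ∈ Metric.ball z δ',
      ∀ x ∈ Metric.ball a δ', ∀ y ∈ Metric.ball b δ',
      p (z, a, b) - r ≤ p (z', x, y) ∧ p (z', x, y) ≤ p (z, a, b) + r := by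
    intro a b
    obtain ⟨δ, h0, h⟩ := Metric.continuousAt_iff.1 (hp.continuousAt (x := (z, a, b))) r hr0
    refine ⟨δ, h0, fun δ' hδ z' hz x hx y hy => ?_⟩
    have : dist ((z', x, y) : E × ℝ × ℝ) (z, a, b) < δ := by
      simp only [Prod.dist_eq, max_lt_iff]
      exact ⟨lt_of_lt_of_le hz hδ, lt_of_lt_of_le hx hδ, lt_of_lt_of_le hy hδ⟩
    have := h this
    rw [Real.dist_eq, abs_lt] at this
    constructor <;> linarith
  obtain ⟨δ1, h1, L1⟩ := loc a b
  obtain ⟨δ2, h2, L2⟩ := loc a' b'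
  obtain ⟨δ3, h3, L3⟩ := loc a b'
  obtain ⟨δ4, h4, L4⟩ := loc a' b
  obtain ⟨δ, h0, l1, l2, l3, l4⟩ : ∃ δ > 0, δ ≤ δ1 ∧ δ ≤ δ2 ∧ δ ≤ δ3 ∧ δ ≤ δ4 :=
    ⟨min (min δ1 δ2) (min δ3 δ4), by positivity, by simp, by simp, by simp, by simp⟩
  replace L1 := L1 δ l1
  replace L2 := L2 δ l2
  replace L3 := L3 δ l3
  replace L4 := L4 δ l4
  have ms : ∀ a : ℝ, MeasurableSet (Metric.ball a δ) := fun a => measurableSet_ball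
  have ae := (H _ _ (ms a) (ms b)).and <| (H _ _ (ms a') (ms b')).and <|
    (H _ _ (ms a) (ms b')).and <| (H _ _ (ms a') (ms b)).and hP
  have ex : ∀ Q : E → Prop, (∀ᵐ y, Q y) → ∃ z' ∈ Metric.ball z δ, Q z' := by
    intro Q hQ
    by_contra! hcon
    have h5 : volume (Metric.ball z δ) = 0 := measure_mono_null (fun y hy => hcon y hy) hQ
    exact (Metric.isOpen_ball.measure_pos volume ⟨z, Metric.mem_ball_self h0⟩).ne' h5
  obtain ⟨z', hz', E1, E2, E3, E4, hPz⟩ := ex _ ae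
  have B1 := K_ge (fun x y => ENNReal.ofReal (p (z', x, y))) _ _ (ms a) (ms b)
    (ENNReal.ofReal (p (z, a, b) - r))
    (fun x hx y hy => ENNReal.ofReal_le_ofReal (L1 z' hz' x hx y hy).1)
  have B2 := K_ge (fun x y => ENNReal.ofReal (p (z', x, y))) _ _ (ms a') (ms b')
    (ENNReal.ofReal (p (z, a', b') - r))
    (fun x hx y hy => ENNReal.ofReal_le_ofReal (L2 z' hz' x hx y hy).1)
  have B3 := K_le (fun x y => ENNReal.ofReal (p (z', x, y))) _ _ (ms a) (ms b')
    (ENNReal.ofReal (p (z, a, b') + r))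
    (fun x hx y hy => ENNReal.ofReal_le_ofReal (L3 z' hz' x hx y hy).2)
  have B4 := K_le (fun x y => ENNReal.ofReal (p (z', x, y))) _ _ (ms a') (ms b)
    (ENNReal.ofReal (p (z, a', b) + r))
    (fun x hx y hy => ENNReal.ofReal_le_ofReal (L4 z' hz' x hx y hy).2)
  simp only [Real.volume_ball] at B1 B2 B3 B4
  set K1 := ∫⁻ x in Metric.ball a δ, ∫⁻ y in Metric.ball b δ, ENNReal.ofReal (p (z', x, y))
  set K2 := ∫⁻ x in Metric.ball a' δ, ∫⁻ y in Metric.ball b' δ, ENNReal.ofReal (p (z', x, y))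
  set K3 := ∫⁻ x in Metric.ball a δ, ∫⁻ y in Metric.ball b' δ, ENNReal.ofReal (p (z', x, y))
  set K4 := ∫⁻ x in Metric.ball a' δ, ∫⁻ y in Metric.ball b δ, ENNReal.ofReal (p (z', x, y))
  have hK : K1 * K2 = K3 * K4 := by
    have : (K1 * P z') * (K2 * P z') = (K3 * P z') * (K4 * P z') := by
      rw [E1, E2, E3, E4]; ring
    have h6 : (K1 * K2) * (P z' * P z') = (K3 * K4) * (P z' * P z') := by
      calc _ = (K1 * P z') * (K2 * P z') := by ring
        _ = _ := this
        _ = _ := by ring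
    exact (ENNReal.mul_left_inj (mul_ne_zero (hP0 _) (hP0 _)) (ENNReal.mul_ne_top hPz hPz)).1 h6
  set V := ENNReal.ofReal (2 * δ) * ENNReal.ofReal (2 * δ) with hV
  have hV0 : V ≠ 0 := by
    have : ENNReal.ofReal (2 * δ) ≠ 0 := by
      rw [Ne, ENNReal.ofReal_eq_zero]; linarith
    exact mul_ne_zero this this
  have hVt : V ≠ ∞ := ENNReal.mul_ne_top ENNReal.ofReal_ne_top ENNReal.ofReal_ne_top
  have fin : ENNReal.ofReal ((p (z, a, b) - r) * (p (z, a', b') - r)) * (V * V) ≤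
      ENNReal.ofReal ((p (z, a, b') + r) * (p (z, a', b) + r)) * (V * V) := by
    rw [ENNReal.ofReal_mul (by linarith), ENNReal.ofReal_mul (by have := hpos (z, a, b'); linarith)]
    calc _ = (ENNReal.ofReal (p (z, a, b) - r) * V) * (ENNReal.ofReal (p (z, a', b') - r) * V) := by
          ring
      _ ≤ K1 * K2 := mul_le_mul' B1 B2
      _ = K3 * K4 := hK
      _ ≤ (ENNReal.ofReal (p (z, a, b') + r) * V) * (ENNReal.ofReal (p (z, a', b) + r) * V) :=
          mul_le_mul' B3 B4
      _ = _ := by ring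
  rw [ENNReal.mul_le_mul_iff_left (mul_ne_zero hV0 hV0) (ENNReal.mul_ne_top hVt hVt)] at fin
  rw [ENNReal.ofReal_le_ofReal_iff
    (mul_nonneg (by have := hpos (z, a, b'); linarith) (by have := hpos (z, a', b); linarith))] at fin
  linarith

lemma condExp_formula {Ω E : Type*} (m : MeasurableSpace Ω) [mΩ : MeasurableSpace Ω] [MeasureSpace E]
    (μ : Measure Ω) [IsProbabilityMeasure μ] (Z : Ω → E) (hZ : Measurable Z)
    (hmd : m = MeasurableSpace.comap Z inferInstance) (hm : m ≤ mΩ)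
    (S : Set Ω) (hS : MeasurableSet S) (K P : E → ℝ≥0∞) (hK : Measurable K) (hP : Measurable P)
    (hKP : ∀ z, K z ≤ P z)
    (hP0 : ∀ z, P z ≠ 0) (hPt : ∀ᵐ z, P z ≠ ∞)
    (hZP : μ.map Z = volume.withDensity P)
    (hSK : ∀ v, MeasurableSet v → μ (Z ⁻¹' v ∩ S) = ∫⁻ z in v, K z) :
    μ⟦S | m⟧ =ᵐ[μ] fun x => (K (Z x) / P (Z x)).toReal := by
  symm
  have hle : ∀ z, K z / P z ≤ 1 := fun z => ENNReal.div_le_of_le_mul (by simpa using hKP z)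
  have hmeas : Measurable[m] fun x => (K (Z x) / P (Z x)).toReal := by
    have h1 : Measurable fun z => (K z / P z).toReal := (hK.div hP).ennreal_toReal
    rw [hmd]
    exact h1.comp (comap_measurable Z)
  have hmeas' : Measurable fun x => K (Z x) / P (Z x) := (hK.div hP).comp hZ
  have hint : Integrable (fun x => (K (Z x) / P (Z x)).toReal) μ := by
    refine Integrable.of_bound (hmeas.mono hm le_rfl).aestronglyMeasurable 1 (ae_of_all _ fun x => ?_)
    rw [Real.norm_of_nonneg ENNReal.toReal_nonneg]
    exact ENNReal.toReal_le_of_le_ofReal (by norm_num) (by simpa using hle (Z x))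
  refine ae_eq_condExp_of_forall_setIntegral_eq hm ?_ (fun _ _ _ => hint.integrableOn) ?_
    hmeas.stronglyMeasurable.aestronglyMeasurable
  · exact (integrable_const (1:ℝ)).indicator hS
  · intro u hu _
    rw [hmd] at hu
    obtain ⟨v, hv, rfl⟩ := hu
    rw [integral_toReal hmeas'.aemeasurable (ae_of_all _ fun x => (hle _).trans_lt ENNReal.one_lt_top)]
    rw [setIntegral_indicator hS]
    simp only [integral_const, smul_eq_mul, mul_one, Measure.real, Measure.restrict_apply_univ]
    change (∫⁻ (a : Ω) in Z ⁻¹' v, (K / P) (Z a) ∂μ).toReal = _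
    rw [hSK v hv, ← setLIntegral_map hv (hK.div hP) hZ, hZP,
      setLIntegral_withDensity_eq_setLIntegral_mul _ hP (hK.div hP) hv]
    congr 1
    refine lintegral_congr_ae (ae_restrict_of_ae ?_)
    filter_upwards [hPt] with z hz
    exact ENNReal.mul_div_cancel (hP0 z) hz

lemma div_iff_mul (K A B P : ℝ≥0∞) (hP0 : P ≠ 0) (hPt : P ≠ ∞) (hK : K ≤ P) (hA : A ≤ P)
    (hB : B ≤ P) :
    (K / P).toReal = (A / P).toReal * (B / P).toReal ↔ K * P = A * B := by
  have hK' := ne_top_of_le_ne_top hPt hK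
  have hA' := ne_top_of_le_ne_top hPt hA
  have hB' := ne_top_of_le_ne_top hPt hB
  have hp : P.toReal ≠ 0 := (ENNReal.toReal_pos hP0 hPt).ne'
  rw [← ENNReal.toReal_eq_toReal_iff' (ENNReal.mul_ne_top hK' hPt) (ENNReal.mul_ne_top hA' hB')]
  simp only [ENNReal.toReal_div, ENNReal.toReal_mul]
  field_simp

lemma glue_add {d : ℕ} (k l : Fin d) (hkl : k ≠ l) (z : {i : Fin d // i ≠ k ∧ i ≠ l} → ℝ)
    (a b u v : ℝ) :
    glue k l (z, a, b) + u • (Pi.single k (1:ℝ) : Fin d → ℝ) + v • (Pi.single l (1:ℝ) : Fin d → ℝ) =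
      glue k l (z, a + u, b + v) := by
  funext i
  by_cases h1 : i = k
  · subst h1
    simp [glue_k, hkl]
  · by_cases h2 : i = l
    · subst h2
      simp [glue_l _ _ hkl, hkl.symm]
    · have := glue_r k l (z, a, b) ⟨i, h1, h2⟩
      have h3 := glue_r k l (z, a + u, b + v) ⟨i, h1, h2⟩
      simp only at this h3
      simp [this, h3, h1, h2]

/-- Let `π : ℝ^d → ℝ` (`d ≥ 2`) be an everywhere positive probability density with existing
second-order partial derivatives (here: `π` is `C²`), and let `μ` be the probability measure
with density `π`. For distinct coordinates `k ≠ ℓ`, the coordinate projections `X_k` and `X_ℓ`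
are conditionally independent given the σ-algebra generated by the remaining coordinates
if and only if `∂²(log π)/∂x_k ∂x_ℓ` vanishes everywhere. -/
theorem stmt0 (d : ℕ) (hd : 2 ≤ d)
    (π : (Fin d → ℝ) → ℝ) (hpos : ∀ x, 0 < π x) (hsmooth : ContDiff ℝ 2 π)
    (μ : Measure (Fin d → ℝ))
    (hμ : μ = volume.withDensity fun x => ENNReal.ofReal (π x))
    [IsProbabilityMeasure μ]
    (k l : Fin d) (hkl : k ≠ l)
    (m : MeasurableSpace (Fin d → ℝ))
    (hm_def : m = MeasurableSpace.comap
      (fun (x : Fin d → ℝ) (i : {i : Fin d // i ≠ k ∧ i ≠ l}) => x i.1) MeasurableSpace.pi)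
    (hm : m ≤ MeasurableSpace.pi) :
    CondIndepFun m hm (fun x => x k) (fun x => x l) μ ↔
      ∀ x : Fin d → ℝ,
        fderiv ℝ (fun y => fderiv ℝ (fun z => Real.log (π z)) y (Pi.single k 1)) x
          (Pi.single l 1) = 0 := by
  subst hm_def
  set Z : (Fin d → ℝ) → ({i : Fin d // i ≠ k ∧ i ≠ l} → ℝ) := fun x i => x i.1 with hZdef
  have hZ : Measurable Z := by rw [hZdef]; fun_prop
  set p : ({i : Fin d // i ≠ k ∧ i ≠ l} → ℝ) × ℝ × ℝ → ℝ := fun w => π (glue k l w) with hpdef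
  have hpc : Continuous p := hsmooth.continuous.comp (glue_cont k l)
  have hpp : ∀ w, 0 < p w := fun w => hpos _
  have hpm : Measurable fun w => ENNReal.ofReal (p w) := hpc.measurable.ennreal_ofReal
  set K : Set ℝ → Set ℝ → ({i : Fin d // i ≠ k ∧ i ≠ l} → ℝ) → ℝ≥0∞ := fun s t z =>
    ∫⁻ a in s, ∫⁻ b in t, ENNReal.ofReal (p (z, a, b)) with hK
  have hKm : ∀ s t, Measurable (K s t) := by
    intro s t
    have h1 : Measurable fun y : ({i : Fin d // i ≠ k ∧ i ≠ l} → ℝ) × ℝ =>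
        ∫⁻ b in t, ENNReal.ofReal (p (y.1, y.2, b)) := by
      refine Measurable.lintegral_prod_right 
        (f := fun (y : ({i : Fin d // i ≠ k ∧ i ≠ l} → ℝ) × ℝ) (b : ℝ) =>
          ENNReal.ofReal (p (y.1, y.2, b))) ?_
      exact hpm.comp (g := fun w => ENNReal.ofReal (p w))
        (f := fun w : (({i : Fin d // i ≠ k ∧ i ≠ l} → ℝ) × ℝ) × ℝ => (w.1.1, w.1.2, w.2)) (by fun_prop)
    exact h1.lintegral_prod_right
  have hbase : ∀ v s t, MeasurableSet v → MeasurableSet s → MeasurableSet t →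
      μ (Z ⁻¹' v ∩ ((fun x => x k) ⁻¹' s ∩ (fun x => x l) ⁻¹' t)) = ∫⁻ z in v, K s t z := by
    intro v s t hv hs ht
    have hB : MeasurableSet (Z ⁻¹' v ∩ ((fun x : Fin d → ℝ => x k) ⁻¹' s ∩ (fun x => x l) ⁻¹' t)) :=
      (hZ hv).inter (((measurable_pi_apply k) hs).inter ((measurable_pi_apply l) ht))
    have e1 := setLIntegral_map (μ := (volume : Measure (({i : Fin d // i ≠ k ∧ i ≠ l} → ℝ))).prod
      ((volume : Measure ℝ).prod (volume : Measure ℝ))) hB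
      (hsmooth.continuous.measurable.ennreal_ofReal) (glue_cont k l).measurable
    rw [glue_map k l hkl] at e1
    have e2 : glue k l ⁻¹' (Z ⁻¹' v ∩ ((fun x : Fin d → ℝ => x k) ⁻¹' s ∩ (fun x => x l) ⁻¹' t)) =
        v ×ˢ (s ×ˢ t) := by
      ext w
      have : Z (glue k l w) = w.1 := by funext i; exact glue_r k l w i
      simp [this, glue_k, glue_l k l hkl]
    rw [hμ, withDensity_apply _ hB, e1, e2, setLIntegral_prod _ hpm.aemeasurable]
    refine lintegral_congr fun z => ?_
    rw [setLIntegral_prod]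
    exact (hpm.comp measurable_prodMk_left).aemeasurable
  have hKmono : ∀ s t z, K s t z ≤ K Set.univ Set.univ z := by
    intro s t z
    refine (lintegral_mono fun a => ?_).trans (lintegral_mono_set (Set.subset_univ s))
    exact lintegral_mono_set (Set.subset_univ t)
  have hP0 : ∀ z, K Set.univ Set.univ z ≠ 0 := by
    intro z hz
    have h2 : ∫⁻ y : ℝ × ℝ, ENNReal.ofReal (p (z, y)) = 0 := by
      rw [← hz, hK, Measure.volume_eq_prod, lintegral_prod]
      · simp
      · exact (hpm.comp measurable_prodMk_left).aemeasurable
    have hm2 : Measurable fun y : ℝ × ℝ => ENNReal.ofReal (p (z, y)) :=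
      hpm.comp measurable_prodMk_left
    rw [lintegral_eq_zero_iff hm2] at h2
    obtain ⟨y, hy⟩ := h2.exists
    simp only [Pi.zero_apply, ENNReal.ofReal_eq_zero] at hy
    exact absurd (hpp (z, y)) (not_lt.2 hy)
  have hZP : μ.map Z = volume.withDensity (K Set.univ Set.univ) := by
    ext v hv
    rw [Measure.map_apply hZ hv, withDensity_apply _ hv,
      ← hbase v _ _ hv MeasurableSet.univ MeasurableSet.univ]
    simp
  have hPt : ∀ᵐ z, K Set.univ Set.univ z ≠ ∞ := by
    have h1 : ∫⁻ z, K Set.univ Set.univ z ≠ ∞ := by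
      have := hbase Set.univ _ _ MeasurableSet.univ MeasurableSet.univ MeasurableSet.univ
      rw [Measure.restrict_univ] at this
      rw [← this]
      exact measure_ne_top _ _
    filter_upwards [ae_lt_top (hKm _ _) h1] with z hz using hz.ne
  have hmk : Measurable fun x : Fin d → ℝ => x k := measurable_pi_apply k
  have hml : Measurable fun x : Fin d → ℝ => x l := measurable_pi_apply l
  have hcond : ∀ s t, MeasurableSet s → MeasurableSet t →
      μ⟦(fun x => x k) ⁻¹' s ∩ (fun x => x l) ⁻¹' t | MeasurableSpace.comap Z MeasurableSpace.pi⟧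
        =ᵐ[μ] fun x => (K s t (Z x) / K Set.univ Set.univ (Z x)).toReal := by
    intro s t hs ht
    exact condExp_formula _ μ Z hZ rfl hm _ ((hmk hs).inter (hml ht)) (K s t) _ (hKm _ _) (hKm _ _)
      (hKmono s t) hP0 hPt hZP (fun v hv => hbase v s t hv hs ht)
  have hCI : CondIndepFun (MeasurableSpace.comap Z MeasurableSpace.pi) hm
      (fun x => x k) (fun x => x l) μ ↔
      ∀ s t, MeasurableSet s → MeasurableSet t → ∀ᵐ z,
        K s t z * K Set.univ Set.univ z = K s Set.univ z * K Set.univ t z := by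
    rw [condIndepFun_iff_condExp_inter_preimage_eq_mul hmk hml]
    refine forall_congr' fun s => forall_congr' fun t => forall_congr' fun hs =>
      forall_congr' fun ht => ?_
    have c1 := hcond s t hs ht
    have c2 := hcond s Set.univ hs MeasurableSet.univ
    have c3 := hcond Set.univ t MeasurableSet.univ ht
    simp only [Set.preimage_univ, Set.inter_univ, Set.univ_inter] at c2 c3
    have hset : MeasurableSet {z | (K s t z / K Set.univ Set.univ z).toReal =
        (K s Set.univ z / K Set.univ Set.univ z).toReal *
        (K Set.univ t z / K Set.univ Set.univ z).toReal} :=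
      measurableSet_eq_fun ((hKm _ _).div (hKm _ _)).ennreal_toReal
        (((hKm _ _).div (hKm _ _)).ennreal_toReal.mul ((hKm _ _).div (hKm _ _)).ennreal_toReal)
    have step : (∀ᵐ x ∂μ, (K s t (Z x) / K Set.univ Set.univ (Z x)).toReal =
        (K s Set.univ (Z x) / K Set.univ Set.univ (Z x)).toReal *
        (K Set.univ t (Z x) / K Set.univ Set.univ (Z x)).toReal) ↔
        ∀ᵐ z, K s t z * K Set.univ Set.univ z = K s Set.univ z * K Set.univ t z := by
      rw [← ae_map_iff hZ.aemeasurable hset, hZP, ae_withDensity_iff (hKm _ _)]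
      refine Filter.eventually_congr ?_
      filter_upwards [hPt] with z hz
      rw [div_iff_mul _ _ _ _ (hP0 z) hz (hKmono _ _ _) (hKmono _ _ _) (hKmono _ _ _)]
      exact ⟨fun h => h (hP0 z), fun h _ => h⟩
    rw [← step]
    refine Filter.eventually_congr ?_
    filter_upwards [c1, c2, c3] with x h1 h2 h3
    rw [h1, h2, h3]
  have hlog : ContDiff ℝ 2 (fun z => Real.log (π z)) := hsmooth.log fun x => (hpos x).ne'
  rw [hCI, cross_iff _ hlog]
  constructor
  · intro H x u v
    have H' : ∀ s t : Set ℝ, MeasurableSet s → MeasurableSet t → ∀ᵐ z,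
      (∫⁻ a in s, ∫⁻ b in t, ENNReal.ofReal (p (z, a, b))) * K Set.univ Set.univ z =
      (∫⁻ a in s, ∫⁻ b, ENNReal.ofReal (p (z, a, b))) *
        (∫⁻ a, ∫⁻ b in t, ENNReal.ofReal (p (z, a, b))) := by
      intro s t hs ht
      filter_upwards [H s t hs ht] with z hz
      simpa only [hK, Measure.restrict_univ] using hz
    have cr := cross_of_K p hpc hpp _ hP0 hPt H'
    have eq := le_antisymm (cr (Z x) (x k + u) (x l + v) (x k) (x l))
      (cr (Z x) (x k + u) (x l) (x k) (x l + v))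
    have g := glue_add k l hkl (Z x) (x k) (x l)
    have gs : glue k l (Z x, x k, x l) = x := glue_self k l x
    have g1 := g u v
    have g2 := g u 0
    have g3 := g 0 v
    rw [gs] at g1 g2 g3
    simp only [zero_smul, add_zero] at g2 g3
    rw [g1, g2, g3, ← Real.log_mul (hpos _).ne' (hpos _).ne',
      ← Real.log_mul (hpos _).ne' (hpos _).ne']
    simp only [hpdef, gs] at eq
    rw [eq]
  · intro H s t _ _
    refine Filter.Eventually.of_forall fun z => ?_
    have := K_of_cross (fun a b => ENNReal.ofReal (p (z, a, b)))
      (hpm.comp measurable_prodMk_left) ?_ s t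
    · simpa only [hK, Measure.restrict_univ] using this
    · intro a b a' b'
      rw [← ENNReal.ofReal_mul (hpp _).le, ← ENNReal.ofReal_mul (hpp _).le]
      congr 1
      have h := H (glue k l (z, a, b)) (a' - a) (b' - b)
      have g := glue_add k l hkl z a b
      have g1 := g (a' - a) (b' - b)
      have g2 := g (a' - a) 0
      have g3 := g 0 (b' - b)
      simp only [zero_smul, add_zero, add_sub_cancel] at g1 g2 g3
      rw [g1, g2, g3, ← Real.log_mul (hpos _).ne' (hpos _).ne',
        ← Real.log_mul (hpos _).ne' (hpos _).ne'] at h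
      have h' := Real.log_injOn_pos (mul_pos (hpos _) (hpos _)) (mul_pos (hpos _) (hpos _)) h
      simp only [hpdef]
      linarith
end

section
/- Let π : ℝ² → ℝ be an everywhere strictly positive probability density with respect to Lebesgue measure whose second-order partial derivatives exist everywhere (e.g., π is C²), and let μ be the probability measure on ℝ² with density π. Then the two coordinate projections X₁(x) = x₁ and X₂(x) = x₂ are independent random variables under μ if and only if the mixed partial derivative ∂²(log π)/∂x₁ ∂x₂ (x) = 0 for all x ∈ ℝ². -/
open MeasureTheory ProbabilityTheory

lemma line_hasDerivAt {f : (Fin 2 → ℝ) → ℝ} (hf : Differentiable ℝ f) (x v : Fin 2 → ℝ) (t : ℝ) :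
    HasDerivAt (fun s : ℝ => f (x + s • v)) (fderiv ℝ f (x + t • v) v) t := by
  have h1 : HasDerivAt (fun s : ℝ => x + s • v) v t := by
    simpa using ((hasDerivAt_id t).smul_const v).const_add x
  exact (hf (x + t • v)).hasFDerivAt.comp_hasDerivAt t h1

lemma mixed_iff {L : (Fin 2 → ℝ) → ℝ} (hL : ContDiff ℝ 2 L) (v w : Fin 2 → ℝ) :
    (∀ x, fderiv ℝ (fun y => fderiv ℝ L y v) x w = 0) ↔
      ∀ (x : Fin 2 → ℝ) (t s : ℝ), L (x + t • v + s • w) + L x = L (x + t • v) + L (x + s • w) := by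
  have hd : Differentiable ℝ L := hL.differentiable (by norm_num)
  have hG : Differentiable ℝ (fun y => fderiv ℝ L y v) := by
    have : ContDiff ℝ 1 (fderiv ℝ L) := hL.fderiv_right (by norm_num)
    exact (this.differentiable (by norm_num)).clm_apply (differentiable_const v)
  constructor
  · intro h x t s
    have hc : ∀ (y : Fin 2 → ℝ) (s : ℝ), fderiv ℝ L (y + s • w) v = fderiv ℝ L y v := by
      intro y s
      have := is_const_of_deriv_eq_zero (f := fun s : ℝ => fderiv ℝ L (y + s • w) v)
        (fun s => (line_hasDerivAt hG y w s).differentiableAt)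
        (fun s => by rw [(line_hasDerivAt hG y w s).deriv, h]) s 0
      simpa using this
    have key : ∀ t, HasDerivAt (fun t : ℝ => L (x + s • w + t • v) - L (x + t • v)) 0 t := by
      intro t
      have := (line_hasDerivAt hd (x + s • w) v t).sub (line_hasDerivAt hd x v t)
      rwa [add_right_comm, hc, sub_self] at this
    have := is_const_of_deriv_eq_zero (fun t => (key t).differentiableAt)
      (fun t => (key t).deriv) t 0
    simp only [zero_smul, add_zero] at this
    rw [add_right_comm]
    linarith
  · intro h x
    have hc : ∀ s : ℝ, fderiv ℝ L (x + s • w) v = fderiv ℝ L x v := by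
      intro s
      have h1 := line_hasDerivAt hd (x + s • w) v 0
      have h2 := (line_hasDerivAt hd x v 0).add_const (L (x + s • w) - L x)
      simp only [zero_smul, add_zero] at h1 h2
      refine h1.unique (h2.congr_of_eventuallyEq (Filter.Eventually.of_forall fun t => ?_))
      have := h x t s
      simp only [add_right_comm x (s • w)]
      linarith
    have h1 := line_hasDerivAt hG x w 0
    simp only [zero_smul, add_zero, hc] at h1
    exact h1.unique (hasDerivAt_const _ _)

lemma cross_of_prod {p : ℝ × ℝ → ℝ} (hp : Continuous p) (hpos : ∀ x, 0 < p x)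
    (f g : ℝ → ENNReal)
    (h : ∀ᵐ x ∂((volume : Measure ℝ).prod volume), ENNReal.ofReal (p x) = f x.1 * g x.2)
    (a a' b b' : ℝ) : p (a, b) * p (a', b') = p (a, b') * p (a', b) := by
  have hA := Measure.ae_ae_of_ae_prod h
  have dA := Measure.dense_of_ae hA
  have step : ∀ z ∈ {a | ∀ᵐ b, ENNReal.ofReal (p (a, b)) = f a * g b} ×ˢ
      {a | ∀ᵐ b, ENNReal.ofReal (p (a, b)) = f a * g b},
      ∀ b b', p (z.1, b) * p (z.2, b') = p (z.1, b') * p (z.2, b) := by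
    rintro ⟨a, a'⟩ ⟨ha, ha'⟩ b b'
    have dB := Measure.dense_of_ae (Filter.Eventually.and ha ha')
    have hcl : IsClosed {q : ℝ × ℝ | p (a, q.1) * p (a', q.2) = p (a, q.2) * p (a', q.1)} :=
      isClosed_eq (by fun_prop) (by fun_prop)
    refine closure_minimal (fun q hq => ?_) hcl ((dB.prod dB) (b, b'))
    · obtain ⟨c, c'⟩ := q
      obtain ⟨⟨h1, h2⟩, h3, h4⟩ := hq
      simp only at h1 h2 h3 h4
      have : ENNReal.ofReal (p (a, c) * p (a', c')) = ENNReal.ofReal (p (a, c') * p (a', c)) := by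
        rw [ENNReal.ofReal_mul (hpos _).le, ENNReal.ofReal_mul (hpos _).le, h1, h2, h3, h4]
        ring
      exact (ENNReal.ofReal_eq_ofReal_iff (mul_pos (hpos _) (hpos _)).le
        (mul_pos (hpos _) (hpos _)).le).1 this
  have hcl : IsClosed {z : ℝ × ℝ | ∀ b b', p (z.1, b) * p (z.2, b') = p (z.1, b') * p (z.2, b)} := by
    simp only [Set.ofPred_forall]
    exact isClosed_iInter fun b => isClosed_iInter fun b' =>
      isClosed_eq (by fun_prop) (by fun_prop)
  have := (dA.prod dA).closure_eq ▸ closure_minimal step hcl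
  exact this (Set.mem_univ (a, a')) b b'

lemma indep_iff {p : ℝ × ℝ → ℝ} (hp : Continuous p) (hpos : ∀ x, 0 < p x)
    (ν : Measure (ℝ × ℝ)) (hν : ν = volume.withDensity fun x => ENNReal.ofReal (p x))
    [IsProbabilityMeasure ν] :
    IndepFun Prod.fst Prod.snd ν ↔
      ∀ a a' b b', p (a, b) * p (a', b') = p (a, b') * p (a', b) := by
  have hpm : Measurable fun x => ENNReal.ofReal (p x) := hp.measurable.ennreal_ofReal
  constructor
  · intro h
    rw [indepFun_iff_map_prod_eq_prod_map_map measurable_fst.aemeasurable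
      measurable_snd.aemeasurable] at h
    have hac : ν ≪ (volume : Measure ℝ).prod volume := by
      rw [hν]; exact withDensity_absolutelyContinuous _ _
    have h1 : ν.map Prod.fst ≪ volume :=
      (hac.map measurable_fst).trans Measure.quasiMeasurePreserving_fst.absolutelyContinuous
    have h2 : ν.map Prod.snd ≪ volume :=
      (hac.map measurable_snd).trans Measure.quasiMeasurePreserving_snd.absolutelyContinuous
    have : IsProbabilityMeasure (ν.map Prod.fst) :=
      Measure.isProbabilityMeasure_map measurable_fst.aemeasurable
    have : IsProbabilityMeasure (ν.map Prod.snd) :=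
      Measure.isProbabilityMeasure_map measurable_snd.aemeasurable
    have hid : ν.map (fun x => (x.1, x.2)) = ν := by simp
    rw [hid, ← Measure.withDensity_rnDeriv_eq _ _ h1, ← Measure.withDensity_rnDeriv_eq _ _ h2,
      prod_withDensity (Measure.measurable_rnDeriv _ _) (Measure.measurable_rnDeriv _ _)] at h
    have hae := (withDensity_eq_iff hpm.aemeasurable (by
        have := Measure.measurable_rnDeriv (ν.map Prod.fst) volume
        have := Measure.measurable_rnDeriv (ν.map Prod.snd) volume
        fun_prop) (by
      rw [← setLIntegral_univ, ← withDensity_apply _ MeasurableSet.univ, ← hν]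
      simp)).1 (hν.symm.trans h)
    exact cross_of_prod hp hpos _ _ hae
  · intro h
    have hfac : (fun x => ENNReal.ofReal (p x)) =
        fun z : ℝ × ℝ => ENNReal.ofReal (p (z.1, 0)) * ENNReal.ofReal (p (0, z.2) / p (0, 0)) := by
      funext z
      rw [← ENNReal.ofReal_mul (hpos _).le]
      congr 1
      have := h z.1 0 z.2 0
      have := hpos (0, 0)
      field_simp
      linarith
    rw [hfac, Measure.volume_eq_prod, ← prod_withDensity (f := fun a => ENNReal.ofReal (p (a, 0)))
      (g := fun b => ENNReal.ofReal (p (0, b) / p (0, 0))) (by fun_prop) (by fun_prop)] at hν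
    set m1 := (volume : Measure ℝ).withDensity fun a => ENNReal.ofReal (p (a, 0))
    set m2 := (volume : Measure ℝ).withDensity fun b => ENNReal.ofReal (p (0, b) / p (0, 0))
    have hu : m1 Set.univ * m2 Set.univ = 1 := by
      rw [← Measure.prod_prod, ← hν]; simp
    rw [indepFun_iff_measure_inter_preimage_eq_mul]
    intro s t _ _
    rw [← Set.prod_eq, ← Set.prod_univ, ← Set.univ_prod, hν, Measure.prod_prod, Measure.prod_prod,
      Measure.prod_prod]
    calc m1 s * m2 t = m1 s * m2 t * (m1 Set.univ * m2 Set.univ) := by rw [hu, mul_one]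
      _ = _ := by ring

/-- Let `π : ℝ² → ℝ` be an everywhere positive probability density with existing second-order
partial derivatives (here: `π` is `C²`), and let `μ` be the probability measure with density
`π`. The two coordinate projections are independent under `μ` if and only if
`∂²(log π)/∂x₁ ∂x₂` vanishes everywhere. -/
theorem stmt1 (π : (Fin 2 → ℝ) → ℝ) (hpos : ∀ x, 0 < π x) (hsmooth : ContDiff ℝ 2 π)
    (μ : Measure (Fin 2 → ℝ))
    (hμ : μ = volume.withDensity fun x => ENNReal.ofReal (π x))
    [IsProbabilityMeasure μ] :
    IndepFun (fun x : Fin 2 → ℝ => x 0) (fun x : Fin 2 → ℝ => x 1) μ ↔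
      ∀ x : Fin 2 → ℝ,
        fderiv ℝ (fun y => fderiv ℝ (fun z => Real.log (π z)) y (Pi.single 0 1)) x
          (Pi.single 1 1) = 0 := by
  have hvec : ∀ a b t s : ℝ, (![a, b] + t • Pi.single 0 1 + s • Pi.single 1 1 : Fin 2 → ℝ)
      = ![a + t, b + s] := by
    intro a b t s; ext i; fin_cases i <;> simp [Matrix.vecHead, Matrix.vecTail]
  have hvec1 : ∀ a b t : ℝ, (![a, b] + t • Pi.single 0 1 : Fin 2 → ℝ) = ![a + t, b] := by
    intro a b t; ext i; fin_cases i <;> simp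
  have hvec2 : ∀ a b s : ℝ, (![a, b] + s • Pi.single 1 1 : Fin 2 → ℝ) = ![a, b + s] := by
    intro a b t; ext i; fin_cases i <;> simp
  have hlog : ∀ x y z w, Real.log (π x) + Real.log (π y) = Real.log (π z) + Real.log (π w) ↔
      π x * π y = π z * π w := by
    intro x y z w
    rw [← Real.log_mul (hpos _).ne' (hpos _).ne', ← Real.log_mul (hpos _).ne' (hpos _).ne']
    exact Real.log_injOn_pos.eq_iff (mul_pos (hpos _) (hpos _)) (mul_pos (hpos _) (hpos _))
  rw [mixed_iff (hsmooth.log fun x => (hpos x).ne')]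
  simp only [hlog]
  have mp := volume_preserving_finTwoArrow ℝ
  have hm : Measurable (MeasurableEquiv.finTwoArrow : (Fin 2 → ℝ) ≃ᵐ ℝ × ℝ) :=
    MeasurableEquiv.measurable _
  have hν : μ.map (MeasurableEquiv.finTwoArrow : (Fin 2 → ℝ) ≃ᵐ ℝ × ℝ) =
      volume.withDensity fun q : ℝ × ℝ => ENNReal.ofReal (π ![q.1, q.2]) := by
    ext s hs
    rw [Measure.map_apply hm hs, hμ, withDensity_apply _ (hm hs), withDensity_apply _ hs,
      ← mp.setLIntegral_comp_preimage_emb (MeasurableEquiv.measurableEmbedding _)]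
    congr 1
    funext x
    congr 2
    ext i; fin_cases i <;> rfl
  have : IsProbabilityMeasure (μ.map (MeasurableEquiv.finTwoArrow : (Fin 2 → ℝ) ≃ᵐ ℝ × ℝ)) :=
    Measure.isProbabilityMeasure_map hm.aemeasurable
  have hc : Continuous fun q : ℝ × ℝ => π ![q.1, q.2] :=
    hsmooth.continuous.comp (by fun_prop)
  have key := indep_iff hc (fun _ => hpos _) _ hν
  have h0 : IndepFun (fun x : Fin 2 → ℝ => x 0) (fun x : Fin 2 → ℝ => x 1) μ ↔
      IndepFun Prod.fst Prod.snd
        (μ.map (MeasurableEquiv.finTwoArrow : (Fin 2 → ℝ) ≃ᵐ ℝ × ℝ)) := by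
    rw [indepFun_iff_measure_inter_preimage_eq_mul, indepFun_iff_measure_inter_preimage_eq_mul]
    refine forall_congr' fun s => forall_congr' fun t => forall_congr' fun hs =>
      forall_congr' fun ht => ?_
    rw [Measure.map_apply hm ((measurable_fst hs).inter (measurable_snd ht)),
      Measure.map_apply hm (measurable_fst hs), Measure.map_apply hm (measurable_snd ht)]
    rfl
  rw [h0, key]
  constructor
  · intro h x t s
    have hx : x = ![x 0, x 1] := by ext i; fin_cases i <;> rfl
    rw [hx, hvec, hvec1, hvec2]
    exact (h (x 0 + t) (x 0) (x 1 + s) (x 1))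
  · intro h a a' b b'
    have := h ![a', b'] (a - a') (b - b')
    rw [hvec, hvec1, hvec2] at this
    simpa using this
end

section
/- Let μ and ν be probability measures on ℝ^d, each with a positive continuous density. Then there exists a measurable lower triangular monotone map S : ℝ^d → ℝ^d that transports μ to ν, i.e., the pushforward of μ under S equals ν. -/
open MeasureTheory

/-- A map `S : ℝ^d → ℝ^d` is lower triangular if each component `S_k` depends only on the
coordinates `x_1, …, x_k`. -/
def LowerTriangular (d : ℕ) (S : (Fin d → ℝ) → Fin d → ℝ) : Prop :=
  ∀ k : Fin d, ∀ x y : Fin d → ℝ, (∀ i ≤ k, x i = y i) → S x k = S y k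

/-- A map `S : ℝ^d → ℝ^d` is monotone (in the triangular sense) if for each `k` and each fixed
`x_1, …, x_{k-1}`, the map `t ↦ S_k(x_1,…,x_{k-1},t)` is strictly increasing. -/
def MonotoneLast (d : ℕ) (S : (Fin d → ℝ) → Fin d → ℝ) : Prop :=
  ∀ (k : Fin d) (x : Fin d → ℝ), StrictMono fun t => S (Function.update x k t) k

/-- A probability measure on `ℝ^d` has a positive continuous density (w.r.t. Lebesgue measure). -/
def HasPosContDensity (d : ℕ) (μ : Measure (Fin d → ℝ)) : Prop :=
  ∃ p : (Fin d → ℝ) → ℝ, Continuous p ∧ (∀ x, 0 < p x) ∧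
    μ = volume.withDensity fun x => ENNReal.ofReal (p x)


open MeasureTheory ProbabilityTheory Filter Topology

lemma aux_cdf_strict (ρ : Measure ℝ) [IsProbabilityMeasure ρ] (h : volume ≪ ρ) :
    StrictMono (cdf ρ) := by
  intro a b hab
  have h1 : ρ (Set.Ioc a b) ≠ 0 := by
    intro h0
    have := h h0
    simp at this
    linarith
  have h2 : ρ (Set.Ioc a b) = ENNReal.ofReal (cdf ρ b - cdf ρ a) := by
    conv_lhs => rw [← measure_cdf ρ]
    rw [StieltjesFunction.measure_Ioc]
  rw [h2] at h1
  by_contra hc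
  exact h1 (ENNReal.ofReal_of_nonpos (by linarith))

lemma aux_cdf_cont (ρ : Measure ℝ) [IsProbabilityMeasure ρ] (h : ρ ≪ volume) :
    Continuous (cdf ρ) := by
  rw [continuous_iff_continuousAt]
  intro x
  rw [(monotone_cdf ρ).continuousAt_iff_leftLim_eq_rightLim, StieltjesFunction.rightLim_eq]
  have h2 : ρ {x} = ENNReal.ofReal (cdf ρ x - Function.leftLim (cdf ρ) x) := by
    conv_lhs => rw [← measure_cdf ρ]
    rw [StieltjesFunction.measure_singleton]
  have h3 : ρ {x} = 0 := h (by simp)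
  rw [h3, eq_comm, ENNReal.ofReal_eq_zero] at h2
  have := (monotone_cdf ρ).leftLim_le (le_refl x)
  linarith

lemma aux_cdf_exists (ρ : Measure ℝ) [IsProbabilityMeasure ρ] (h : ρ ≪ volume)
    {u : ℝ} (h0 : 0 < u) (h1 : u < 1) : ∃ t, cdf ρ t = u := by
  obtain ⟨a, ha⟩ := ((tendsto_cdf_atBot ρ).eventually (gt_mem_nhds h0)).exists
  obtain ⟨b, hb⟩ := ((tendsto_cdf_atTop ρ).eventually (lt_mem_nhds h1)).exists
  exact mem_range_of_exists_le_of_exists_ge (aux_cdf_cont ρ h) ⟨a, ha.le⟩ ⟨b, hb.le⟩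

lemma aux_cdf_pos (ρ : Measure ℝ) [IsProbabilityMeasure ρ] (h : volume ≪ ρ) (t : ℝ) :
    0 < cdf ρ t ∧ cdf ρ t < 1 :=
  ⟨(cdf_nonneg ρ (t-1)).trans_lt (aux_cdf_strict ρ h (by linarith)),
    (aux_cdf_strict ρ h (show t < t + 1 by linarith)).trans_le (cdf_le_one ρ (t+1))⟩

/-- The one-dimensional monotone rearrangement. -/
noncomputable def auxT (ρ σ : Measure ℝ) (t : ℝ) : ℝ := sInf {s | cdf ρ t ≤ cdf σ s}

lemma auxT_cdf (ρ σ : Measure ℝ) [IsProbabilityMeasure ρ] [IsProbabilityMeasure σ]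
    (hρ' : volume ≪ ρ) (hσ : σ ≪ volume) (hσ' : volume ≪ σ) (t : ℝ) :
    cdf σ (auxT ρ σ t) = cdf ρ t := by
  obtain ⟨s, hs⟩ := aux_cdf_exists σ hσ (aux_cdf_pos ρ hρ' t).1 (aux_cdf_pos ρ hρ' t).2
  have : {s | cdf ρ t ≤ cdf σ s} = Set.Ici s := by
    ext r
    simp [← hs, (aux_cdf_strict σ hσ').le_iff_le]
  rw [auxT, this, csInf_Ici, hs]

lemma auxT_le_iff (ρ σ : Measure ℝ) [IsProbabilityMeasure ρ] [IsProbabilityMeasure σ]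
    (hρ' : volume ≪ ρ) (hσ : σ ≪ volume) (hσ' : volume ≪ σ) (t s : ℝ) :
    auxT ρ σ t ≤ s ↔ cdf ρ t ≤ cdf σ s := by
  rw [← auxT_cdf ρ σ hρ' hσ hσ' t, (aux_cdf_strict σ hσ').le_iff_le]

lemma auxT_strict (ρ σ : Measure ℝ) [IsProbabilityMeasure ρ] [IsProbabilityMeasure σ]
    (hρ' : volume ≪ ρ) (hσ : σ ≪ volume) (hσ' : volume ≪ σ) :
    StrictMono (auxT ρ σ) := by
  intro a b hab
  rw [← (aux_cdf_strict σ hσ').lt_iff_lt, auxT_cdf ρ σ hρ' hσ hσ', auxT_cdf ρ σ hρ' hσ hσ']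
  exact aux_cdf_strict ρ hρ' hab

lemma auxT_map (ρ σ : Measure ℝ) [IsProbabilityMeasure ρ] [IsProbabilityMeasure σ]
    (hρ : ρ ≪ volume) (hρ' : volume ≪ ρ) (hσ : σ ≪ volume) (hσ' : volume ≪ σ) :
    ρ.map (auxT ρ σ) = σ := by
  have hm : Measurable (auxT ρ σ) := (auxT_strict ρ σ hρ' hσ hσ').monotone.measurable
  have := Measure.isProbabilityMeasure_map (μ := ρ) hm.aemeasurable
  refine Measure.ext_of_Iic _ _ fun s => ?_
  rw [Measure.map_apply hm measurableSet_Iic]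
  obtain ⟨t, ht⟩ := aux_cdf_exists ρ hρ (aux_cdf_pos σ hσ' s).1 (aux_cdf_pos σ hσ' s).2
  have : auxT ρ σ ⁻¹' Set.Iic s = Set.Iic t := by
    ext r
    simp [auxT_le_iff ρ σ hρ' hσ hσ', ← ht, (aux_cdf_strict ρ hρ').le_iff_le]
  rw [this, ← ofReal_cdf, ← ofReal_cdf, ht]

lemma aux_cdf_meas {α : Type*} [MeasurableSpace α] (κ : Kernel α ℝ) [IsMarkovKernel κ] :
    Measurable fun p : α × ℝ => cdf (κ p.1) p.2 := by
  have h : MeasurableSet {q : (α × ℝ) × ℝ | q.2 ≤ q.1.2} :=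
    measurableSet_le (by fun_prop) (by fun_prop)
  have := Kernel.measurable_kernel_prodMk_left (κ := Kernel.prodMkRight ℝ κ) h
  have h2 := this.ennreal_toReal
  convert h2 using 2 with p
  rw [cdf_eq_real]
  rfl

lemma aux_ae {α : Type*} [MeasurableSpace α] (lam : Measure α) [SigmaFinite lam]
    (μ : Measure (α × ℝ)) [IsProbabilityMeasure μ]
    (h1 : μ ≪ lam.prod volume) (h2 : lam.prod volume ≪ μ) :
    μ.fst ≪ lam ∧ lam ≪ μ.fst ∧
      ∀ᵐ x ∂μ.fst, μ.condKernel x ≪ volume ∧ volume ≪ μ.condKernel x := by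
  have g1 := gaussianReal_absolutelyContinuous 0 one_ne_zero
  have g2 := gaussianReal_absolutelyContinuous' 0 one_ne_zero
  set γ := gaussianReal 0 1 with hγ
  have h1' : μ.fst ⊗ₘ μ.condKernel ≪ lam ⊗ₘ Kernel.const α γ := by
    rw [μ.disintegrate, Measure.compProd_const]
    exact h1.trans (Measure.AbsolutelyContinuous.rfl.prod g2)
  have h2' : lam ⊗ₘ Kernel.const α γ ≪ μ.fst ⊗ₘ μ.condKernel := by
    rw [μ.disintegrate, Measure.compProd_const]
    exact (Measure.AbsolutelyContinuous.rfl.prod g1).trans h2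
  have c1 := Measure.absolutelyContinuous_of_compProd h1'
  have c2 := Measure.absolutelyContinuous_of_compProd h2'
  refine ⟨c1, c2, ?_⟩
  filter_upwards [h1'.kernel_of_compProd, c1.ae_le h2'.kernel_of_compProd] with x hx hx'
  exact ⟨hx.trans g1, g2.trans hx'⟩

/-- Last-coordinate splitting. -/
def auxE (n : ℕ) : (Fin (n+1) → ℝ) ≃ᵐ (Fin n → ℝ) × ℝ :=
  (MeasurableEquiv.piFinSuccAbove (fun _ => ℝ) (Fin.last n)).trans MeasurableEquiv.prodComm

lemma auxE_apply (n : ℕ) (x : Fin (n+1) → ℝ) :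
    auxE n x = (fun i => x i.castSucc, x (Fin.last n)) := by
  ext i
  · simp [auxE, MeasurableEquiv.prodComm, Fin.init]
  · rfl

lemma auxE_mp (n : ℕ) : MeasurePreserving (auxE n) volume
    ((volume : Measure (Fin n → ℝ)).prod volume) :=
  Measure.measurePreserving_swap.comp
    (volume_preserving_piFinSuccAbove (fun _ : Fin (n+1) => ℝ) (Fin.last n))

theorem aux_main (d : ℕ) : ∀ (μ ν : Measure (Fin d → ℝ))
    [IsProbabilityMeasure μ] [IsProbabilityMeasure ν]
    (_ : μ ≪ volume) (_ : volume ≪ μ) (_ : ν ≪ volume) (_ : volume ≪ ν),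
    ∃ S : (Fin d → ℝ) → Fin d → ℝ,
      Measurable S ∧ LowerTriangular d S ∧ MonotoneLast d S ∧ μ.map S = ν := by
  induction d with
  | zero =>
    intro μ ν _ _ _ _ _ _
    refine ⟨id, measurable_id, fun k => k.elim0, fun k => k.elim0, ?_⟩
    rw [Measure.map_id]
    ext s hs
    rcases Set.eq_empty_or_nonempty s with h | h
    · simp [h]
    · rw [Subsingleton.eq_univ_of_nonempty h]; simp
  | succ n ih =>
    intro μ ν _ _ hμ hμ' hν hν'
    have hE := (auxE n).measurable
    set μ2 := μ.map (auxE n) with hμ2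
    set ν2 := ν.map (auxE n) with hν2
    have iμ : IsProbabilityMeasure μ2 := Measure.isProbabilityMeasure_map hE.aemeasurable
    have iν : IsProbabilityMeasure ν2 := Measure.isProbabilityMeasure_map hE.aemeasurable
    obtain ⟨a1, a2, a3⟩ := aux_ae (volume : Measure (Fin n → ℝ)) μ2
      (by rw [← (auxE_mp n).map_eq]; exact hμ.map hE)
      (by rw [← (auxE_mp n).map_eq]; exact hμ'.map hE)
    obtain ⟨b1, b2, b3⟩ := aux_ae (volume : Measure (Fin n → ℝ)) ν2
      (by rw [← (auxE_mp n).map_eq]; exact hν.map hE)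
      (by rw [← (auxE_mp n).map_eq]; exact hν'.map hE)
    obtain ⟨S', mS, tS, sS, pS⟩ := ih μ2.fst ν2.fst a1 a2 b1 b2
    set κ := μ2.condKernel with hκ
    set η := ν2.condKernel with hη
    have b4 : ∀ᵐ x ∂μ2.fst, η (S' x) ≪ volume ∧ volume ≪ η (S' x) := by
      rw [← pS] at b3
      exact ae_of_ae_map mS.aemeasurable b3
    obtain ⟨A, hA, mA, hAg⟩ := (a3.and b4).exists_measurable_mem
    classical
    let T : (Fin n → ℝ) → ℝ → ℝ := fun x t => if x ∈ A then auxT (κ x) (η (S' x)) t else t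
    have mT : Measurable fun p : (Fin n → ℝ) × ℝ => T p.1 p.2 := by
      refine measurable_of_Iic fun s => ?_
      have : (fun p : (Fin n → ℝ) × ℝ => T p.1 p.2) ⁻¹' Set.Iic s =
          ((Prod.fst ⁻¹' A) ∩ {p | cdf (κ p.1) p.2 ≤ cdf (η (S' p.1)) s}) ∪
          ((Prod.fst ⁻¹' A)ᶜ ∩ {p | p.2 ≤ s}) := by
        ext p
        by_cases hp : p.1 ∈ A
        · have := hAg _ hp
          simp [T, hp, auxT_le_iff _ _ this.1.2 this.2.1 this.2.2]
        · simp [T, hp]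
      rw [this]
      refine ((measurable_fst mA).inter (measurableSet_le (aux_cdf_meas κ) ?_)).union
        ((measurable_fst mA).compl.inter (measurableSet_le measurable_snd measurable_const))
      have hg : Measurable fun p : (Fin n → ℝ) × ℝ => (S' p.1, s) := by fun_prop
      exact (aux_cdf_meas η).comp hg
    have sT : ∀ x, StrictMono (T x) := by
      intro x
      by_cases hx : x ∈ A
      · have := hAg _ hx
        simpa [T, hx] using auxT_strict _ _ this.1.2 this.2.1 this.2.2
      · intro a b hab; simpa [T, hx] using hab
    let S2 : (Fin n → ℝ) × ℝ → (Fin n → ℝ) × ℝ := fun p => (S' p.1, T p.1 p.2)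
    have mS2 : Measurable S2 := (mS.comp measurable_fst).prodMk mT
    have pS2 : μ2.map S2 = ν2 := by
      ext B hB
      rw [Measure.map_apply mS2 hB, ← μ2.disintegrate κ, ← ν2.disintegrate η,
        Measure.compProd_apply (mS2 hB), Measure.compProd_apply hB]
      rw [← pS, lintegral_map (Kernel.measurable_kernel_prodMk_left hB) mS]
      refine lintegral_congr_ae ?_
      filter_upwards [hA] with x hx
      have := hAg _ hx
      have hm := auxT_map _ _ this.1.1 this.1.2 this.2.1 this.2.2
      have hTm : Measurable (auxT (κ x) (η (S' x))) :=
        (auxT_strict _ _ this.1.2 this.2.1 this.2.2).monotone.measurable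
      rw [← hm, Measure.map_apply hTm (measurable_prodMk_left hB)]
      congr 1
      ext t
      simp [S2, T, hx]
    let S : (Fin (n+1) → ℝ) → Fin (n+1) → ℝ := fun x => (auxE n).symm (S2 (auxE n x))
    have hS1 : ∀ x i, S x (Fin.castSucc i) = S' (fun j => x j.castSucc) i := by
      intro x i
      have : auxE n (S x) = S2 (auxE n x) := by simp [S]
      rw [auxE_apply, auxE_apply] at this
      exact congrFun (congrArg Prod.fst this) i
    have hS2 : ∀ x, S x (Fin.last n) = T (fun j => x j.castSucc) (x (Fin.last n)) := by
      intro x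
      have : auxE n (S x) = S2 (auxE n x) := by simp [S]
      rw [auxE_apply, auxE_apply] at this
      exact congrArg Prod.snd this
    have mSS : Measurable S := (auxE n).symm.measurable.comp (mS2.comp hE)
    refine ⟨S, mSS, ?_, ?_, ?_⟩
    · intro k x y hxy
      induction k using Fin.lastCases with
      | last =>
        rw [hS2, hS2, hxy _ le_rfl]
        congr 1
        ext j
        exact hxy _ (Fin.le_last _)
      | cast k =>
        rw [hS1, hS1]
        exact tS k _ _ fun i hi => hxy _ (by simpa using hi)
    · intro k x
      induction k using Fin.lastCases with
      | last =>
        intro a b hab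
        simp only [hS2, Function.update_self]
        have : ∀ t, (fun j : Fin n => Function.update x (Fin.last n) t j.castSucc) =
            fun j => x j.castSucc := by
          intro t; ext j
          rw [Function.update_of_ne (Fin.castSucc_lt_last j).ne]
        rw [this, this]
        exact sT _ hab
      | cast k =>
        intro a b hab
        simp only [hS1]
        have : ∀ t, (fun j : Fin n => Function.update x k.castSucc t j.castSucc) =
            Function.update (fun j => x j.castSucc) k t := by
          intro t; ext j
          simp [Function.update_apply]
        rw [this, this]
        exact sS k _ hab
    · apply (auxE n).map_measurableEquiv_injective
      rw [Measure.map_map hE mSS]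
      have : (auxE n) ∘ S = S2 ∘ auxE n := by ext1 x; simp [S]
      rw [this, ← Measure.map_map mS2 hE]
      exact pS2

lemma aux_dens (d : ℕ) (μ : Measure (Fin d → ℝ)) (h : HasPosContDensity d μ) :
    μ ≪ volume ∧ volume ≪ μ := by
  obtain ⟨p, hc, hp, rfl⟩ := h
  refine ⟨withDensity_absolutelyContinuous _ _, withDensity_absolutelyContinuous' ?_ ?_⟩
  · exact (hc.measurable.ennreal_ofReal).aemeasurable
  · exact ae_of_all _ fun x => by simpa using hp x

/-- Between any two probability measures on `ℝ^d` with positive continuous densities there is a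
measurable lower triangular monotone transport map. -/
theorem stmt3 (d : ℕ) (μ ν : Measure (Fin d → ℝ))
    [IsProbabilityMeasure μ] [IsProbabilityMeasure ν]
    (hμ : HasPosContDensity d μ) (hν : HasPosContDensity d ν) :
    ∃ S : (Fin d → ℝ) → Fin d → ℝ,
      Measurable S ∧ LowerTriangular d S ∧ MonotoneLast d S ∧ μ.map S = ν :=
  aux_main d μ ν (aux_dens d μ hμ).1 (aux_dens d μ hμ).2 (aux_dens d ν hν).1 (aux_dens d ν hν).2
end

section
/- Let μ and ν be probability measures on ℝ^d, each with a positive continuous density. If S and S' are two continuous lower triangular monotone maps from ℝ^d to ℝ^d that both transport μ to ν, then S = S' everywhere on ℝ^d. -/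
open MeasureTheory

lemma tri_inj (d : ℕ) (S : (Fin d → ℝ) → Fin d → ℝ) (hStri : LowerTriangular d S)
    (hSmon : MonotoneLast d S) (k : Fin d) (x z : Fin d → ℝ)
    (h : ∀ i < k, S x i = S z i) : ∀ i < k, x i = z i := by
  intro i
  induction i using WellFoundedLT.induction with
  | ind i ih =>
    intro hi
    have h1 : S (Function.update z i (x i)) i = S (Function.update z i (z i)) i := by
      rw [Function.update_eq_self, ← h i hi]
      apply hStri
      intro j hj
      rcases hj.lt_or_eq with hj | rfl
      · rw [Function.update_of_ne hj.ne, ih j hj (hj.trans hi)]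
      · simp
    exact (hSmon i z).injective h1

lemma key (d : ℕ) (μ ν : Measure (Fin d → ℝ))
    [IsProbabilityMeasure μ]
    (hpos : ∀ V : Set (Fin d → ℝ), IsOpen V → μ V = 0 → V = ∅)
    (S S' : (Fin d → ℝ) → Fin d → ℝ)
    (hScont : Continuous S) (hS'cont : Continuous S')
    (hStri : LowerTriangular d S) (hS'tri : LowerTriangular d S')
    (hSmon : MonotoneLast d S) (hS'mon : MonotoneLast d S')
    (hSmap : μ.map S = ν) (hS'map : μ.map S' = ν)
    (k : Fin d) (heq : ∀ i < k, ∀ x, S x i = S' x i) (a : Fin d → ℝ) :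
    S a k ≤ S' a k := by
  by_contra! hlt
  obtain ⟨c, hc1, hc2⟩ := exists_between hlt
  have hck : Continuous fun x => S x k := (continuous_apply k).comp hScont
  have hck' : Continuous fun x => S' x k := (continuous_apply k).comp hS'cont
  have hev : ∀ᶠ x in nhds a, S' x k < c ∧ c < S x k :=
    (hck'.continuousAt.eventually_lt continuousAt_const hc1).and
      (continuousAt_const.eventually_lt hck.continuousAt hc2)
  obtain ⟨δ, hδ, hball⟩ := Metric.nhds_basis_closedBall.eventually_iff.1 hev
  let P : (Fin d → ℝ) → Fin d → ℝ := fun y i => if i < k then y i else 0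
  have hP : Continuous P := by
    refine continuous_pi fun i => ?_
    by_cases h : i < k
    · simpa [P, h] using continuous_apply i
    · simpa [P, h] using continuous_const
  have hPS : ∀ x, P (S' x) = P (S x) := by
    intro x
    funext i
    by_cases h : i < k
    · simp [P, h, heq i h x]
    · simp [P, h]
  have hcpt : IsCompact ((fun x => P (S x)) '' Metric.closedBall a δ) :=
    (isCompact_closedBall a δ).image (hP.comp hScont)
  let E : Set (Fin d → ℝ) := P ⁻¹' ((fun x => P (S x)) '' Metric.closedBall a δ) ∩ {y | y k ≤ c}
  have hE : MeasurableSet E :=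
    ((hcpt.isClosed.preimage hP).inter
      (isClosed_le (continuous_apply k) continuous_const)).measurableSet
  have hA : μ (S ⁻¹' E) = ν E := by rw [← hSmap, Measure.map_apply hScont.measurable hE]
  have hB : μ (S' ⁻¹' E) = ν E := by rw [← hS'map, Measure.map_apply hS'cont.measurable hE]
  have hsub : S ⁻¹' E ⊆ S' ⁻¹' E := by
    rintro x ⟨⟨z, hz, hzx⟩, hx⟩
    refine ⟨⟨z, hz, hzx.trans (hPS x).symm⟩, ?_⟩
    simp only [Set.mem_ofPred_eq] at hx ⊢
    have hzi : ∀ i < k, x i = z i := by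
      apply tri_inj d S hStri hSmon
      intro i hi
      have := congrFun hzx i
      simpa [P, hi] using this.symm
    have hw : Function.update z k (a k) ∈ Metric.closedBall a δ := by
      rw [Metric.mem_closedBall, dist_pi_le_iff hδ.le] at hz ⊢
      intro i
      by_cases h : i = k
      · subst h; simpa using hδ.le
      · simpa [h] using hz i
    obtain ⟨h1, h2⟩ := hball hw
    have hxz : ∀ i ≤ k, x i = Function.update z k (x k) i := by
      intro i hi
      rcases hi.lt_or_eq with hi | rfl
      · rw [Function.update_of_ne hi.ne, hzi i hi]
      · simp
    rw [hStri k _ _ hxz] at hx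
    rw [hS'tri k _ _ hxz]
    have hxa : x k < a k := (hSmon k z).lt_iff_lt.1 (lt_of_le_of_lt hx h2)
    exact ((hS'mon k z hxa).trans h1).le
  have hdiff : μ (S' ⁻¹' E \ S ⁻¹' E) = 0 := by
    rw [measure_sdiff hsub (hScont.measurable hE).nullMeasurableSet (measure_ne_top _ _), hA, hB,
      tsub_self]
  have hV := hpos (Metric.ball a δ) Metric.isOpen_ball (measure_mono_null (fun x hx => by
    have hx' := Metric.ball_subset_closedBall hx
    obtain ⟨h1, h2⟩ := hball hx'
    exact ⟨⟨⟨x, hx', (hPS x).symm⟩, h1.le⟩, fun h => absurd h.2 (not_le.2 h2)⟩) hdiff)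
  exact (Metric.nonempty_ball.2 hδ).ne_empty hV

theorem stmt4 (d : ℕ) (μ ν : Measure (Fin d → ℝ))
    [IsProbabilityMeasure μ] [IsProbabilityMeasure ν]
    (hμ : HasPosContDensity d μ) (hν : HasPosContDensity d ν)
    (S S' : (Fin d → ℝ) → Fin d → ℝ)
    (hScont : Continuous S) (hS'cont : Continuous S')
    (hStri : LowerTriangular d S) (hS'tri : LowerTriangular d S')
    (hSmon : MonotoneLast d S) (hS'mon : MonotoneLast d S')
    (hSmap : μ.map S = ν) (hS'map : μ.map S' = ν) :
    S = S' := by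
  have hpos : ∀ V : Set (Fin d → ℝ), IsOpen V → μ V = 0 → V = ∅ := by
    obtain ⟨p, hp, hp0, rfl⟩ := hμ
    intro V hV h0
    refine (hV.measure_eq_zero_iff (volume : Measure (Fin d → ℝ))).1 ?_
    refine withDensity_absolutelyContinuous' (f := fun x => ENNReal.ofReal (p x)) ?_ ?_ h0
    · exact hp.measurable.ennreal_ofReal.aemeasurable
    · exact Filter.Eventually.of_forall fun x => (ENNReal.ofReal_pos.2 (hp0 x)).ne'
  have main : ∀ k : Fin d, ∀ x, S x k = S' x k := by
    intro k
    induction k using WellFoundedLT.induction with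
    | ind k ih =>
      intro x
      exact le_antisymm
        (key d μ ν hpos S S' hScont hS'cont hStri hS'tri hSmon hS'mon hSmap hS'map k ih x)
        (key d μ ν hpos S' S hS'cont hScont hS'tri hStri hS'mon hSmon hS'map hSmap k
          (fun i hi x => (ih i hi x).symm) x)
  funext x k
  exact main k x
end

section
/- Let μ and ν be probability measures on ℝ, each with a positive continuous density, and let F_μ and F_ν denote their cumulative distribution functions. Then there exists a unique strictly increasing map T : ℝ → ℝ that transports μ to ν (i.e., the pushforward of μ under T equals ν); moreover this T is continuous and satisfies F_ν(T(x)) = F_μ(x) for every x ∈ ℝ. -/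
open MeasureTheory

lemma aux_cdf (μ : Measure ℝ) [IsProbabilityMeasure μ]
    (hμ : ∃ p : ℝ → ℝ, Continuous p ∧ (∀ x, 0 < p x) ∧
      μ = volume.withDensity fun x => ENNReal.ofReal (p x)) :
    StrictMono (ProbabilityTheory.cdf μ) ∧
      ∀ c : ℝ, (∃ x, ProbabilityTheory.cdf μ x = c) ↔ 0 < c ∧ c < 1 := by
  obtain ⟨p, hp, hpos, hm⟩ := hμ
  have hac : (volume : Measure ℝ) ≪ μ := by
    rw [hm]
    apply withDensity_absolutelyContinuous'
    · exact hp.measurable.ennreal_ofReal.aemeasurable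
    · exact Filter.Eventually.of_forall fun x => by simpa using hpos x
  have hac' : μ ≪ (volume : Measure ℝ) := by
    rw [hm]; exact withDensity_absolutelyContinuous _ _
  have hmono : StrictMono (ProbabilityTheory.cdf μ) := by
    intro a b hab
    by_contra hle
    have h1 : μ (Set.Ioc a b) = 0 := by
      rw [← ProbabilityTheory.measure_cdf μ, StieltjesFunction.measure_Ioc]
      exact ENNReal.ofReal_of_nonpos (by linarith)
    have h2 := hac h1
    rw [Real.volume_Ioc, ENNReal.ofReal_eq_zero] at h2
    linarith
  have hcont : Continuous (ProbabilityTheory.cdf μ) := by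
    rw [continuous_iff_continuousAt]
    intro x
    rw [(ProbabilityTheory.monotone_cdf μ).continuousAt_iff_leftLim_eq_rightLim,
      StieltjesFunction.rightLim_eq]
    have h1 : μ {x} = 0 := hac' (by simp)
    rw [← ProbabilityTheory.measure_cdf μ, StieltjesFunction.measure_singleton,
      ENNReal.ofReal_eq_zero] at h1
    have := (ProbabilityTheory.monotone_cdf μ).leftLim_le (le_refl x)
    linarith
  refine ⟨hmono, fun c => ⟨?_, ?_⟩⟩
  · rintro ⟨x, rfl⟩
    exact ⟨(ProbabilityTheory.cdf_nonneg μ (x - 1)).trans_lt (hmono (by linarith)),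
      (hmono (show x < x + 1 by linarith)).trans_le (ProbabilityTheory.cdf_le_one μ _)⟩
  · rintro ⟨h0, h1⟩
    obtain ⟨a, ha⟩ := ((ProbabilityTheory.tendsto_cdf_atBot μ).eventually (gt_mem_nhds h0)).exists
    obtain ⟨b, hb⟩ := ((ProbabilityTheory.tendsto_cdf_atTop μ).eventually (lt_mem_nhds h1)).exists
    exact mem_range_of_exists_le_of_exists_ge hcont ⟨a, ha.le⟩ ⟨b, hb.le⟩

/-- Between two probability measures `μ`, `ν` on `ℝ` with positive continuous densities, there
is a unique strictly increasing transport map `T`; moreover any such `T` is continuous and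
satisfies `F_ν(T(x)) = F_μ(x)` for all `x`, where `F_μ(x) = μ((-∞, x])`. -/
theorem stmt5 (μ ν : Measure ℝ) [IsProbabilityMeasure μ] [IsProbabilityMeasure ν]
    (hμ : ∃ p : ℝ → ℝ, Continuous p ∧ (∀ x, 0 < p x) ∧
      μ = volume.withDensity fun x => ENNReal.ofReal (p x))
    (hν : ∃ q : ℝ → ℝ, Continuous q ∧ (∀ x, 0 < q x) ∧
      ν = volume.withDensity fun x => ENNReal.ofReal (q x)) :
    (∃! T : ℝ → ℝ, StrictMono T ∧ μ.map T = ν) ∧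
      ∀ T : ℝ → ℝ, StrictMono T → μ.map T = ν →
        Continuous T ∧ ∀ x : ℝ, ν (Set.Iic (T x)) = μ (Set.Iic x) := by
  obtain ⟨hF, hFr⟩ := aux_cdf μ hμ
  obtain ⟨hG, hGr⟩ := aux_cdf ν hν
  have hpre : ∀ T : ℝ → ℝ, StrictMono T → ∀ x, μ.map T (Set.Iic (T x)) = μ (Set.Iic x) := by
    intro T hT x
    rw [Measure.map_apply hT.monotone.measurable measurableSet_Iic]
    congr 1
    ext y
    simp [hT.le_iff_le]
  have hsurj : ∀ T : ℝ → ℝ,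
      (∀ x, ProbabilityTheory.cdf ν (T x) = ProbabilityTheory.cdf μ x) →
      Function.Surjective T := by
    intro T h y
    obtain ⟨x, hx⟩ := (hFr _).2 ((hGr _).1 ⟨y, rfl⟩)
    exact ⟨x, hG.injective (by rw [h, hx])⟩
  have hkey : ∀ T : ℝ → ℝ, StrictMono T → μ.map T = ν →
      ∀ x, ProbabilityTheory.cdf ν (T x) = ProbabilityTheory.cdf μ x := by
    intro T hT h x
    have h1 := hpre T hT x
    rw [h] at h1
    simp only [ProbabilityTheory.cdf_eq_real, Measure.real, h1]
  constructor
  · have hex : ∀ x, ∃ y, ProbabilityTheory.cdf ν y = ProbabilityTheory.cdf μ x :=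
      fun x => (hGr _).2 ((hFr _).1 ⟨x, rfl⟩)
    choose T hT using hex
    have hTm : StrictMono T := by
      intro a b hab
      rw [← hG.lt_iff_lt, hT, hT]
      exact hF hab
    refine ⟨T, ⟨hTm, ?_⟩, ?_⟩
    · have : IsProbabilityMeasure (μ.map T) :=
        Measure.isProbabilityMeasure_map hTm.monotone.measurable.aemeasurable
      apply Measure.ext_of_Iic
      intro y
      obtain ⟨x, rfl⟩ := hsurj T hT y
      rw [hpre T hTm, ← ProbabilityTheory.ofReal_cdf, ← ProbabilityTheory.ofReal_cdf, hT]
    · rintro S ⟨hS, hSm⟩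
      funext x
      exact hG.injective (by rw [hkey S hS hSm, hT])
  · intro T hT h
    refine ⟨hT.monotone.continuous_of_surjective (hsurj T (hkey T hT h)), fun x => ?_⟩
    have h1 := hpre T hT x
    rwa [h] at h1
end

section
/- Let d ≥ 1 and let Pa : {1,…,d} → subsets of {1,…,d} be the parent map of a directed acyclic graph on {1,…,d}. For each j, let f_j : ℝ^d × ℝ → ℝ be a function such that f_j(x,u) depends only on the coordinates x_i with i ∈ Pa(j), is jointly continuous, and is strictly increasing and surjective onto ℝ in u for each fixed x. Let ν_1,…,ν_d be probability measures on ℝ, each with a positive continuous density, and let T : ℝ^d → ℝ^d be the (well-defined, by acyclicity) map satisfying T(w)_j = f_j(T(w), w_j) for all w and j. For a permutation σ of {1,…,d} compatible with the graph (i.e., i ∈ Pa(j) implies σ^{-1}(i) < σ^{-1}(j)), define R_σ : ℝ^d → ℝ^d by (R_σ u)_k = u_{σ(k)} and S^σ := R_σ ∘ T ∘ R_σ^{-1}. Then: (a) S^σ is a continuous lower triangular monotone map and the pushforward of the product measure ν_{σ(1)} ⊗ ⋯ ⊗ ν_{σ(d)} under S^σ equals the law of (X_{σ(1)},…,X_{σ(d)}),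 where the law of X = (X_1,…,X_d) is the pushforward of ν_1 ⊗ ⋯ ⊗ ν_d under T; (b) for any two compatible permutations σ and τ, S^τ = (R_τ ∘ R_σ^{-1}) ∘ S^σ ∘ (R_σ ∘ R_τ^{-1}), i.e., the triangular transport maps corresponding to any two compatible orderings coincide up to a permutation of coordinates. -/
open MeasureTheory

/-- Let `T` be the structural map of a SEM over a DAG with parent map `Pa` (so
`T(w)_j = f_j(T(w), w_j)`, with `f_j` reading only the parent coordinates, jointly continuous,
strictly increasing and surjective in the noise argument), with independent noises
`ν_1, …, ν_d` having positive continuous densities. For a compatible ordering `σ`, define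
`S σ := R_σ ∘ T ∘ R_σ⁻¹` where `(R_σ u)_k = u_{σ(k)}`. Then:
(a) `S σ` is a continuous lower triangular monotone map transporting `ν_{σ(1)} ⊗ ⋯ ⊗ ν_{σ(d)}`
to the law of `(X_{σ(1)}, …, X_{σ(d)})`, where the law of `X` is the pushforward of
`ν_1 ⊗ ⋯ ⊗ ν_d` under `T`; and
(b) for any two compatible orderings `σ`, `τ`, the maps `S σ` and `S τ` coincide up to a
permutation of coordinates: `S τ = (R_τ ∘ R_σ⁻¹) ∘ S σ ∘ (R_σ ∘ R_τ⁻¹)`. -/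
theorem stmt7 (d : ℕ) (hd : 1 ≤ d)
    (Pa : Fin d → Set (Fin d))
    (f : Fin d → (Fin d → ℝ) → ℝ → ℝ)
    (hdep : ∀ (j : Fin d) (x y : Fin d → ℝ), (∀ i ∈ Pa j, x i = y i) → f j x = f j y)
    (hcont : ∀ j : Fin d, Continuous fun p : (Fin d → ℝ) × ℝ => f j p.1 p.2)
    (hmono : ∀ (j : Fin d) (x : Fin d → ℝ), StrictMono (f j x))
    (hsurj : ∀ (j : Fin d) (x : Fin d → ℝ), Function.Surjective (f j x))
    (ν : Fin d → Measure ℝ) [∀ k, IsProbabilityMeasure (ν k)]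
    (hν : ∀ k, ∃ p : ℝ → ℝ, Continuous p ∧ (∀ x, 0 < p x) ∧
      ν k = volume.withDensity fun x => ENNReal.ofReal (p x))
    (T : (Fin d → ℝ) → Fin d → ℝ)
    (hT : ∀ (w : Fin d → ℝ) (j : Fin d), T w j = f j (T w) (w j))
    (S : Equiv.Perm (Fin d) → (Fin d → ℝ) → Fin d → ℝ)
    (hSdef : ∀ (ρ : Equiv.Perm (Fin d)) (u : Fin d → ℝ) (k : Fin d),
      S ρ u k = T (fun j => u (ρ.symm j)) (ρ k))
    (σ : Equiv.Perm (Fin d))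
    (hσ : ∀ i j : Fin d, i ∈ Pa j → σ.symm i < σ.symm j) :
    (Continuous (S σ) ∧ LowerTriangular d (S σ) ∧ MonotoneLast d (S σ) ∧
      (Measure.pi fun k => ν (σ k)).map (S σ) =
        ((Measure.pi ν).map T).map fun x k => x (σ k)) ∧
    ∀ τ : Equiv.Perm (Fin d), (∀ i j : Fin d, i ∈ Pa j → τ.symm i < τ.symm j) →
      ∀ (u : Fin d → ℝ) (k : Fin d),
        S τ u k = S σ (fun m => u (τ.symm (σ m))) (σ.symm (τ k)) := by
  have key : ∀ (n : ℕ) (j : Fin d), (σ.symm j : ℕ) = n → ∀ w w' : Fin d → ℝ,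
      (∀ i, σ.symm i ≤ σ.symm j → w i = w' i) → T w j = T w' j := by
    intro n
    induction n using Nat.strong_induction_on with
    | _ n ih =>
      intro j hj w w' h
      rw [hT w j, hT w' j, h j le_rfl]
      rw [hdep j (T w) (T w')]
      intro i hi
      have hlt := hσ i j hi
      exact ih (σ.symm i) (by rw [← hj]; exact hlt) i rfl w w'
        (fun m hm => h m (hm.trans hlt.le))
  have cont : ∀ (n : ℕ) (j : Fin d), (σ.symm j : ℕ) = n → Continuous fun w => T w j := by
    classical
    intro n
    induction n using Nat.strong_induction_on with
    | _ n ih =>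
      intro j hj
      have e : (fun w => T w j) =
          fun w => f j (fun i => if i ∈ Pa j then T w i else 0) (w j) := by
        funext w
        rw [hT w j]
        rw [hdep j (T w) (fun i => if i ∈ Pa j then T w i else 0)]
        intro i hi
        simp [hi]
      rw [e]
      have hc : Continuous fun w : Fin d → ℝ => (fun i => if i ∈ Pa j then T w i else 0) := by
        refine continuous_pi fun i => ?_
        by_cases hi : i ∈ Pa j
        · simp only [hi, if_true]
          exact ih (σ.symm i) (by rw [← hj]; exact hσ i j hi) i rfl
        · simp only [hi, if_false]
          exact continuous_const
      exact (hcont j).comp (hc.prodMk (continuous_apply j))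
  have hTc : Continuous T := continuous_pi fun j => cont _ j rfl
  have hS : S σ = (fun x k => x (σ k)) ∘ T ∘ (fun u j => u (σ.symm j)) := by
    funext u k
    exact hSdef σ u k
  have hR : Continuous fun (x : Fin d → ℝ) (k : Fin d) => x (σ k) :=
    continuous_pi fun k => continuous_apply _
  have hR' : Continuous fun (x : Fin d → ℝ) (k : Fin d) => x (σ.symm k) :=
    continuous_pi fun k => continuous_apply _
  refine ⟨⟨?_, ?_, ?_, ?_⟩, ?_⟩
  · rw [hS]
    exact hR.comp (hTc.comp hR')
  · intro k x y h
    rw [hSdef, hSdef]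
    refine key _ (σ k) rfl _ _ fun i hi => h _ ?_
    simpa using hi
  · intro k x s t hst
    simp only [hSdef]
    rw [hT _ (σ k), hT (fun j => Function.update x k t (σ.symm j)) (σ k)]
    rw [hdep (σ k) (T fun j => Function.update x k s (σ.symm j))
      (T fun j => Function.update x k t (σ.symm j))]
    · apply hmono
      simpa using hst
    · intro i hi
      have hlt := hσ i _ hi
      rw [Equiv.symm_apply_apply] at hlt
      refine key _ i rfl _ _ fun m hm => ?_
      have : σ.symm m ≠ k := (hm.trans_lt hlt).ne
      simp [this]
  · have hmp := (measurePreserving_piCongrLeft (α := fun _ : Fin d => ℝ) ν σ).map_eq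
    have hfun : (⇑(MeasurableEquiv.piCongrLeft (fun _ : Fin d => ℝ) σ)) =
        fun (u : Fin d → ℝ) j => u (σ.symm j) := by
      funext u j
      obtain ⟨k, rfl⟩ := σ.surjective j
      rw [MeasurableEquiv.coe_piCongrLeft, Equiv.piCongrLeft_apply_apply]
      simp
    rw [hfun] at hmp
    rw [hS, ← Measure.map_map hR.measurable (hTc.comp hR').measurable,
      ← Measure.map_map hTc.measurable hR'.measurable, hmp]
  · intro τ _ u k
    simp [hSdef]
end

section
/- Let d ≥ 1. For each k ∈ {1,…,d}, let g_k : ℝ^d → ℝ be a measurable function depending only on the coordinates x_1,…,x_{k-1}, let ν_k be a probability measure on ℝ, and let M_k : ℝ → ℝ be a strictly increasing Borel map such that the pushforward of ν_k under M_k is the standard normal distribution N(0,1). Let T : ℝ^d → ℝ^d be the map defined recursively by T(u)_k = g_k(T(u)) + u_k, and let π be the pushforward of the product measure ν_1 ⊗ ⋯ ⊗ ν_d under T. Define S : ℝ^d → ℝ^d by S(x)_k = M_k(x_k − g_k(x)). Then S is a lower triangular monotone map and the pushforward of π under S equals γ^d, the standard Gaussian measure on ℝ^d. -/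
open MeasureTheory ProbabilityTheory

/-- For an additive noise model `X_k = g_k(X_1,…,X_{k-1}) + U_k` with independent noises
`U_k ∼ ν_k`, and strictly increasing Borel maps `M_k` pushing `ν_k` to `N(0,1)`, the map
`S(x)_k = M_k(x_k − g_k(x))` is a lower triangular monotone map transporting the model law `π`
(the pushforward of `ν_1 ⊗ ⋯ ⊗ ν_d` by the structural map `T`) to the standard Gaussian
`γ^d`. -/
theorem stmt14 (d : ℕ) (hd : 1 ≤ d)
    (g : Fin d → (Fin d → ℝ) → ℝ)
    (hgmeas : ∀ k, Measurable (g k))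
    (hgdep : ∀ (k : Fin d) (x y : Fin d → ℝ), (∀ i < k, x i = y i) → g k x = g k y)
    (ν : Fin d → Measure ℝ) [∀ k, IsProbabilityMeasure (ν k)]
    (M : Fin d → ℝ → ℝ)
    (hMmono : ∀ k, StrictMono (M k)) (hMmeas : ∀ k, Measurable (M k))
    (hMpush : ∀ k, (ν k).map (M k) = gaussianReal 0 1)
    (T : (Fin d → ℝ) → Fin d → ℝ)
    (hT : ∀ (u : Fin d → ℝ) (k : Fin d), T u k = g k (T u) + u k)
    (π : Measure (Fin d → ℝ)) (hπ : π = (Measure.pi ν).map T)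
    (S : (Fin d → ℝ) → Fin d → ℝ)
    (hS : ∀ (x : Fin d → ℝ) (k : Fin d), S x k = M k (x k - g k x)) :
    LowerTriangular d S ∧ MonotoneLast d S ∧
      π.map S = Measure.pi fun _ : Fin d => gaussianReal 0 1 := by
  have hTm : ∀ n : ℕ, ∀ k : Fin d, k.val = n → Measurable (fun u => T u k) := by
    intro n
    induction n using Nat.strong_induction_on with
    | _ n ih =>
      intro k hk
      have h1 : (fun u => T u k) =
          fun u => g k (fun i => if i < k then T u i else 0) + u k := by
        funext u
        rw [hT u k]
        congr 1
        apply hgdep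
        intro i hi
        simp [hi]
      rw [h1]
      refine Measurable.add ((hgmeas k).comp (measurable_pi_lambda _ fun i => ?_))
        (measurable_pi_apply k)
      by_cases hi : i < k
      · simp only [hi, if_true]
        exact ih i.val (by have := Fin.lt_def.mp hi; omega) i rfl
      · simp only [hi, if_false]
        exact measurable_const
  have hTmeas : Measurable T := measurable_pi_lambda _ fun k => hTm k.val k rfl
  have hSmeas : Measurable S := by
    refine measurable_pi_lambda _ fun k => ?_
    simp only [hS]
    exact (hMmeas k).comp ((measurable_pi_apply k).sub (hgmeas k))
  refine ⟨?_, ?_, ?_⟩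
  · intro k x y h
    rw [hS, hS, h k le_rfl, hgdep k x y fun i hi => h i hi.le]
  · intro k x s t hst
    simp only [hS, Function.update_self]
    apply hMmono
    rw [hgdep k (Function.update x k s) (Function.update x k t) fun i hi => by
      simp [Function.update_of_ne hi.ne]]
    linarith
  · have hcomp : S ∘ T = fun u k => M k (u k) := by
      funext u k
      simp only [Function.comp, hS]
      congr 1
      have := hT u k
      linarith
    have : ∀ k, IsProbabilityMeasure ((ν k).map (M k)) := fun k =>
      Measure.isProbabilityMeasure_map (hMmeas k).aemeasurable
    rw [hπ, Measure.map_map hSmeas hTmeas, hcomp,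
      Measure.pi_map_pi (fun k => (hMmeas k).aemeasurable)]
    simp only [hMpush]
end

section
/- Let d ≥ 1. For each k ∈ {1,…,d}, let g_k : ℝ^d → ℝ be a measurable function depending only on the coordinates x_1,…,x_{k-1}, let h_k : ℝ → ℝ be a strictly increasing continuous bijection, let ν_k be a probability measure on ℝ, and let M_k : ℝ → ℝ be a strictly increasing Borel map such that the pushforward of ν_k under M_k is the standard normal distribution N(0,1). Let T : ℝ^d → ℝ^d be the map defined recursively by T(u)_k = h_k(g_k(T(u)) + u_k), and let π be the pushforward of the product measure ν_1 ⊗ ⋯ ⊗ ν_d under T. Define S : ℝ^d → ℝ^d by S(x)_k = M_k(h_k^{-1}(x_k) − g_k(x)). Then S is a lower triangular monotone map and the pushforward of π under S equals γ^d, the standard Gaussian measure on ℝ^d. -/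
open MeasureTheory ProbabilityTheory

/-- For a post-nonlinear model `X_k = h_k(g_k(X_1,…,X_{k-1}) + U_k)` with independent noises
`U_k ∼ ν_k`, strictly increasing continuous bijections `h_k`, and strictly increasing Borel maps
`M_k` pushing `ν_k` to `N(0,1)`, the map `S(x)_k = M_k(h_k⁻¹(x_k) − g_k(x))` is a lower
triangular monotone map transporting the model law `π` (the pushforward of `ν_1 ⊗ ⋯ ⊗ ν_d` by
the structural map `T`) to the standard Gaussian `γ^d`. -/
theorem stmt15 (d : ℕ) (hd : 1 ≤ d)
    (g : Fin d → (Fin d → ℝ) → ℝ)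
    (hgmeas : ∀ k, Measurable (g k))
    (hgdep : ∀ (k : Fin d) (x y : Fin d → ℝ), (∀ i < k, x i = y i) → g k x = g k y)
    (h : Fin d → ℝ → ℝ)
    (hhmono : ∀ k, StrictMono (h k)) (hhcont : ∀ k, Continuous (h k))
    (hhbij : ∀ k, Function.Bijective (h k))
    (ν : Fin d → Measure ℝ) [∀ k, IsProbabilityMeasure (ν k)]
    (M : Fin d → ℝ → ℝ)
    (hMmono : ∀ k, StrictMono (M k)) (hMmeas : ∀ k, Measurable (M k))
    (hMpush : ∀ k, (ν k).map (M k) = gaussianReal 0 1)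
    (T : (Fin d → ℝ) → Fin d → ℝ)
    (hT : ∀ (u : Fin d → ℝ) (k : Fin d), T u k = h k (g k (T u) + u k))
    (π : Measure (Fin d → ℝ)) (hπ : π = (Measure.pi ν).map T)
    (S : (Fin d → ℝ) → Fin d → ℝ)
    (hS : ∀ (x : Fin d → ℝ) (k : Fin d),
      S x k = M k (Function.invFun (h k) (x k) - g k x)) :
    LowerTriangular d S ∧ MonotoneLast d S ∧
      π.map S = Measure.pi fun _ : Fin d => gaussianReal 0 1 := by
  have hinvmono : ∀ k, StrictMono (Function.invFun (h k)) := by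
    intro k a b hab
    rw [← (hhmono k).lt_iff_lt, Function.rightInverse_invFun (hhbij k).2 a,
      Function.rightInverse_invFun (hhbij k).2 b]
    exact hab
  have hTm : Measurable T := by
    have key : ∀ n : ℕ, ∀ k : Fin d, k.val = n → Measurable fun u => T u k := by
      intro n
      induction n using Nat.strong_induction_on with
      | _ n ih =>
        intro k hk
        have e : (fun u => T u k)
            = fun u => h k (g k (fun i => if i < k then T u i else 0) + u k) := by
          funext u
          rw [hT u k, hgdep k (T u) (fun i => if i < k then T u i else 0)]
          intro i hi
          simp [hi]
        rw [e]
        refine (hhcont k).measurable.comp (((hgmeas k).comp ?_).add (measurable_pi_apply k))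
        refine measurable_pi_lambda _ fun i => ?_
        by_cases hi : i < k
        · simp only [hi, if_true]
          exact ih i.val (hk ▸ hi) i rfl
        · simp only [hi, if_false]
          exact measurable_const
    exact measurable_pi_lambda _ fun k => key k.val k rfl
  have hSm : Measurable S := by
    refine measurable_pi_lambda _ fun k => ?_
    simp only [hS]
    exact (hMmeas k).comp
      (((hinvmono k).monotone.measurable.comp (measurable_pi_apply k)).sub (hgmeas k))
  refine ⟨?_, ?_, ?_⟩
  · intro k x y hxy
    rw [hS, hS, hxy k le_rfl, hgdep k x y fun i hi => hxy i hi.le]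
  · intro k x a b hab
    have e : g k (Function.update x k a) = g k (Function.update x k b) :=
      hgdep k _ _ fun i hi => by simp [hi.ne]
    simp only [hS, Function.update_self, e]
    exact hMmono k (sub_lt_sub_right (hinvmono k hab) _)
  · rw [hπ, Measure.map_map hSm hTm]
    have e : S ∘ T = fun u k => M k (u k) := by
      funext u k
      simp only [Function.comp_apply]
      rw [hS, hT u k, Function.leftInverse_invFun (hhbij k).1, add_sub_cancel_left]
    have hp : ∀ k, IsProbabilityMeasure ((ν k).map (M k)) := fun k =>
      Measure.isProbabilityMeasure_map (hMmeas k).aemeasurable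
    rw [e, Measure.pi_map_pi (fun k => (hMmeas k).aemeasurable)]
    simp only [hMpush]
end
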